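/- arXiv:2403.11555 — 2 statements merged into one kernel-verified Lean document; each statement's English description precedes it below -/
import Mathlib

section
/- Let t = θ(G) ≥ 2 and set n_2 = 3 and n_t = 2 for t ≥ 3. If G has girth at least 6 and at most n_t vertices of degree at most 2t − 1, then χ_o(G) ≤ 6t. -/
open SimpleGraph

/-- The degree of a vertex, as the cardinality of its neighbor set. -/
noncomputable def deg {V : Type} (G : SimpleGraph V) (v : V) : ℕ := (G.neighborSet v).ncard

/-- `H` is a minor of `G`, via branch sets. -/
def IsMinor {W V : Type} (H : SimpleGraph W) (G : SimpleGraph V) : Prop :=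
  ∃ B : W → Set V,
    (∀ w, (B w).Nonempty) ∧
    (∀ w, (G.induce (B w)).Connected) ∧
    (Pairwise fun w₁ w₂ => Disjoint (B w₁) (B w₂)) ∧
    (∀ w₁ w₂, H.Adj w₁ w₂ → ∃ v₁ ∈ B w₁, ∃ v₂ ∈ B w₂, G.Adj v₁ v₂)

/-- A graph is planar iff it has no `K₅` and no `K₃,₃` minor (Wagner's theorem). -/
def IsPlanar {V : Type} (G : SimpleGraph V) : Prop :=
  ¬ IsMinor (completeGraph (Fin 5)) G ∧
  ¬ IsMinor (completeBipartiteGraph (Fin 3) (Fin 3)) G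

/-- `G` has thickness at most `t`: its edge set partitions into `t` planar subgraphs. -/
def ThicknessLE {V : Type} (G : SimpleGraph V) (t : ℕ) : Prop :=
  ∃ c : Sym2 V → Fin t, ∀ i : Fin t,
    IsPlanar (SimpleGraph.fromEdgeSet {e | e ∈ G.edgeSet ∧ c e = i})

/-- The thickness of a graph. -/
noncomputable def thickness {V : Type} (G : SimpleGraph V) : ℕ :=
  sInf {t | ThicknessLE G t}

/-- `φ` is an odd coloring of `G` with `k` colors. -/
def IsOddColoring {V : Type} (G : SimpleGraph V) {k : ℕ} (φ : V → Fin k) : Prop :=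
  (∀ ⦃u v⦄, G.Adj u v → φ u ≠ φ v) ∧
  ∀ v : V, (G.neighborSet v).Nonempty →
    ∃ c : Fin k, Odd ({u | u ∈ G.neighborSet v ∧ φ u = c}.ncard)

/-- The odd chromatic number of `G`. -/
noncomputable def oddChrom {V : Type} (G : SimpleGraph V) : ℕ :=
  sInf {k | ∃ φ : V → Fin k, IsOddColoring G φ}

/-- `G` is odd `k⁺`-critical. -/
def OddCritical {V : Type} (G : SimpleGraph V) (k : ℕ) : Prop :=
  k ≤ oddChrom G ∧ ∀ H : G.Subgraph, H ≠ ⊤ → oddChrom H.coe < k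

/-- A vertex is `n`-easy if its degree is odd or it has a neighbor of degree `2i`, `1 ≤ i ≤ n`. -/
def NEasy {V : Type} (G : SimpleGraph V) (n : ℕ) (v : V) : Prop :=
  Odd (deg G v) ∨ ∃ u ∈ G.neighborSet v, ∃ i, 1 ≤ i ∧ i ≤ n ∧ deg G u = 2 * i

/-- Some edge of `G` joins the vertex sets `S` and `T`. -/
def Touches {V : Type} (G : SimpleGraph V) (S T : Set V) : Prop :=
  ∃ a ∈ S, ∃ b ∈ T, G.Adj a b

lemma Touches.symm {V : Type} {G : SimpleGraph V} {S T : Set V} (h : Touches G S T) :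
    Touches G T S := by
  obtain ⟨a, ha, b, hb, hab⟩ := h
  exact ⟨b, hb, a, ha, hab.symm⟩

lemma Touches.mono {V : Type} {G : SimpleGraph V} {S T S' T' : Set V} (h : Touches G S T)
    (hS : S ⊆ S') (hT : T ⊆ T') : Touches G S' T' := by
  obtain ⟨a, ha, b, hb, hab⟩ := h
  exact ⟨a, hS ha, b, hT hb, hab⟩

lemma induce_nonempty {V : Type} {G : SimpleGraph V} {S : Set V} (h : (G.induce S).Connected) :
    S.Nonempty := by
  obtain ⟨x⟩ := h.nonempty
  exact ⟨x, x.2⟩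

lemma connected_union_of_touches {V : Type} {G : SimpleGraph V} {S T : Set V}
    (hS : (G.induce S).Connected) (hT : (G.induce T).Connected) (h : Touches G S T) :
    (G.induce (S ∪ T)).Connected := by
  obtain ⟨a, ha, b, hb, hab⟩ := h
  exact connected_induce_union hS.preconnected hT.preconnected ha hb hab

lemma connected_singleton {V : Type} {G : SimpleGraph V} (u : V) :
    (G.induce ({u} : Set V)).Connected := by
  have : Nonempty ({u} : Set V) := ⟨⟨u, rfl⟩⟩
  exact ⟨fun a b => by rw [Subsingleton.elim a b]⟩

/-- Monotonicity of minors in the host graph. -/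
lemma IsMinor.mono {W V : Type} {H : SimpleGraph W} {G G' : SimpleGraph V} (hle : G ≤ G')
    (h : IsMinor H G) : IsMinor H G' := by
  obtain ⟨B, h1, h2, h3, h4⟩ := h
  refine ⟨B, h1, fun w => (h2 w).mono ?_, h3, fun a b hab => ?_⟩
  · intro a b hab
    exact hle hab
  · obtain ⟨x, hx, y, hy, hxy⟩ := h4 a b hab
    exact ⟨x, hx, y, hy, hle hxy⟩

/-- Six disjoint connected sets, three of them touching the other three, form a `K₃,₃` minor. -/
lemma isMinor_completeBipartite {V : Type} {G : SimpleGraph V} (L R : Fin 3 → Set V)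
    (hL : ∀ i, (G.induce (L i)).Connected) (hR : ∀ i, (G.induce (R i)).Connected)
    (dL : Pairwise fun i j => Disjoint (L i) (L j)) (dR : Pairwise fun i j => Disjoint (R i) (R j))
    (dLR : ∀ i j, Disjoint (L i) (R j)) (h : ∀ i j, Touches G (L i) (R j)) :
    IsMinor (completeBipartiteGraph (Fin 3) (Fin 3)) G := by
  refine ⟨Sum.elim L R, ?_, ?_, ?_, ?_⟩
  · rintro (i | i)
    · exact induce_nonempty (hL i)
    · exact induce_nonempty (hR i)
  · rintro (i | i)
    · exact hL i
    · exact hR i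
  · rintro (i | i) (j | j) hij
    · exact dL (fun h => hij (by rw [h]))
    · exact dLR i j
    · exact (dLR j i).symm
    · exact dR (fun h => hij (by rw [h]))
  · rintro (i | i) (j | j) hij
    · simp at hij
    · exact h i j
    · exact (h j i).symm
    · simp at hij

/-- Three internally disjoint connections between `u` and `v`, together with a connected set that
touches all three of them, form a `K₃,₃` minor. -/
lemma isMinor_of_theta {V : Type} {G : SimpleGraph V} {u v : V} (huv : u ≠ v)
    {I J K S : Set V} (hI : (G.induce I).Connected) (hJ : (G.induce J).Connected)
    (hK : (G.induce K).Connected) (hS : (G.induce S).Connected)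
    (uI : Touches G {u} I) (uJ : Touches G {u} J) (uK : Touches G {u} K)
    (vI : Touches G {v} I) (vJ : Touches G {v} J) (vK : Touches G {v} K)
    (sI : Touches G S I) (sJ : Touches G S J) (sK : Touches G S K)
    (dIJ : Disjoint I J) (dIK : Disjoint I K) (dJK : Disjoint J K)
    (dSI : Disjoint S I) (dSJ : Disjoint S J) (dSK : Disjoint S K)
    (huI : u ∉ I) (huJ : u ∉ J) (huK : u ∉ K) (hvI : v ∉ I) (hvJ : v ∉ J) (hvK : v ∉ K)
    (huS : u ∉ S) (hvS : v ∉ S) :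
    IsMinor (completeBipartiteGraph (Fin 3) (Fin 3)) G := by
  have huv' := huv.symm
  refine isMinor_completeBipartite ![{u}, {v}, S] ![I, J, K] ?_ ?_ ?_ ?_ ?_ ?_
  · intro i; fin_cases i
    exacts [connected_singleton u, connected_singleton v, hS]
  · intro i; fin_cases i
    exacts [hI, hJ, hK]
  · intro i j hij
    fin_cases i <;> fin_cases j <;> simp_all [disjoint_comm]
  · intro i j hij
    fin_cases i <;> fin_cases j <;> simp_all [disjoint_comm]
  · intro i j
    fin_cases i <;> fin_cases j <;> simp_all
  · intro i j
    fin_cases i <;> fin_cases j <;> assumption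

/-- Five pairwise touching disjoint connected sets form a `K₅` minor. -/
lemma isMinor_completeGraph_five {V : Type} {G : SimpleGraph V} {A B C D E : Set V}
    (hA : (G.induce A).Connected) (hB : (G.induce B).Connected) (hC : (G.induce C).Connected)
    (hD : (G.induce D).Connected) (hE : (G.induce E).Connected)
    (dAB : Disjoint A B) (dAC : Disjoint A C) (dAD : Disjoint A D) (dAE : Disjoint A E)
    (dBC : Disjoint B C) (dBD : Disjoint B D) (dBE : Disjoint B E)
    (dCD : Disjoint C D) (dCE : Disjoint C E) (dDE : Disjoint D E)
    (tAB : Touches G A B) (tAC : Touches G A C) (tAD : Touches G A D) (tAE : Touches G A E)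
    (tBC : Touches G B C) (tBD : Touches G B D) (tBE : Touches G B E)
    (tCD : Touches G C D) (tCE : Touches G C E) (tDE : Touches G D E) :
    IsMinor (completeGraph (Fin 5)) G := by
  have hconn : ∀ i : Fin 5, (G.induce ((![A, B, C, D, E] : Fin 5 → Set V) i)).Connected := by
    intro i; fin_cases i
    exacts [hA, hB, hC, hD, hE]
  refine ⟨![A, B, C, D, E], fun i => induce_nonempty (hconn i), hconn, ?_, ?_⟩
  · intro i j hij
    fin_cases i <;> fin_cases j <;>
      first
        | exact absurd rfl hij
        | assumption
        | (apply Disjoint.symm; assumption)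
  · intro i j hij
    fin_cases i <;> fin_cases j <;>
      first
        | exact absurd rfl hij
        | assumption
        | (apply Touches.symm; assumption)

/-- The vertices that can be reached from `w` by a walk avoiding `F`. -/
def reachAvoiding {V : Type} (H : SimpleGraph V) (F : Set V) (w : V) : Set V :=
  {z | ∃ p : H.Walk w z, ∀ v ∈ p.support, v ∉ F}

lemma mem_reachAvoiding_self {V : Type} {H : SimpleGraph V} {F : Set V} {w : V} (hw : w ∉ F) :
    w ∈ reachAvoiding H F w :=
  ⟨Walk.nil, by simpa using hw⟩

lemma notMem_of_mem_reachAvoiding {V : Type} {H : SimpleGraph V} {F : Set V} {w z : V}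
    (hz : z ∈ reachAvoiding H F w) : z ∉ F := by
  obtain ⟨p, hp⟩ := hz
  exact hp z p.end_mem_support

lemma mem_reachAvoiding_of_adj {V : Type} {H : SimpleGraph V} {F : Set V} {w s z : V}
    (hs : s ∈ reachAvoiding H F w) (hz : z ∉ F) (h : H.Adj s z) : z ∈ reachAvoiding H F w := by
  obtain ⟨p, hp⟩ := hs
  refine ⟨p.concat h, fun v hv => ?_⟩
  rw [Walk.support_concat, List.mem_append, List.mem_singleton] at hv
  rcases hv with hv | rfl
  · exact hp v hv
  · exact hz

lemma connected_reachAvoiding {V : Type} {H : SimpleGraph V} {F : Set V} {w : V} (hw : w ∉ F) :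
    (H.induce (reachAvoiding H F w)).Connected := by
  classical
  refine induce_connected_of_patches w (mem_reachAvoiding_self hw) ?_
  rintro v ⟨p, hp⟩
  refine ⟨{x | x ∈ p.support}, fun x hx => ?_, p.start_mem_support, p.end_mem_support,
    p.connected_induce_support.preconnected _ _⟩
  exact ⟨p.takeUntil x hx, fun y hy => hp y (p.support_takeUntil_subset_support hx hy)⟩

/-- The edges of `H` outside `C` cannot be split in two nonempty parts that only meet at vertices
covered by `C`. -/
def NonSep {V : Type} (H : SimpleGraph V) (C : Set (Sym2 V)) : Prop :=
  ∀ E : Set (Sym2 V), E ⊆ H.edgeSet \ C → E.Nonempty → ((H.edgeSet \ C) \ E).Nonempty →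
    ∃ v, (∀ g ∈ C, v ∉ g) ∧ (∃ f ∈ E, v ∈ f) ∧ ∃ f ∈ (H.edgeSet \ C) \ E, v ∈ f

lemma NonSep.eq_of_chord {V : Type} {H : SimpleGraph V} {C : Set (Sym2 V)} (hC : NonSep H C)
    {a b : V} (hab : H.Adj a b) (habC : s(a, b) ∉ C) (ha : ∃ g ∈ C, a ∈ g) (hb : ∃ g ∈ C, b ∈ g)
    {g : Sym2 V} (hg : g ∈ H.edgeSet) (hgC : g ∉ C) : g = s(a, b) := by
  by_contra hne
  obtain ⟨v, hv, ⟨f, rfl, hvf⟩, -⟩ := hC {s(a, b)}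
    (by rintro _ rfl; exact ⟨hab, habC⟩) ⟨_, rfl⟩ ⟨g, ⟨hg, hgC⟩, hne⟩
  obtain ⟨ga, hga, ha⟩ := ha
  obtain ⟨gb, hgb, hb⟩ := hb
  rcases Sym2.mem_iff.1 hvf with rfl | rfl
  · exact hv _ hga ha
  · exact hv _ hgb hb

lemma NonSep.exists_adj {V : Type} {H : SimpleGraph V} {C : Set (Sym2 V)} (hC : NonSep H C)
    {S : Set V} (hS : ∀ s ∈ S, ∀ g ∈ C, s ∉ g) {a b : V} (haS : a ∈ S) (hab : H.Adj a b)
    {g : Sym2 V} (hg : g ∈ H.edgeSet) (hgC : g ∉ C) (hgS : ∀ s ∈ S, s ∉ g) :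
    ∃ s ∈ S, ∃ z, z ∉ S ∧ (∀ g ∈ C, z ∉ g) ∧ H.Adj s z := by
  obtain ⟨v, hv, ⟨f, ⟨hfH, s, hs, hsf⟩, hvf⟩, f', ⟨hf', hf'E⟩, hvf'⟩ :=
    hC {f | f ∈ H.edgeSet ∧ ∃ s ∈ S, s ∈ f}
    (by rintro f ⟨hf, s, hs, hsf⟩; exact ⟨hf, fun hfC => hS s hs f hfC hsf⟩)
    ⟨s(a, b), hab, a, haS, by simp⟩ ⟨g, ⟨hg, hgC⟩, fun h => by
      obtain ⟨-, s, hs, hsg⟩ := h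
      exact hgS s hs hsg⟩
  have hvS : v ∉ S := fun h => hf'E ⟨hf'.1, v, h, hvf'⟩
  have hsv : s ≠ v := by rintro rfl; exact hvS hs
  refine ⟨s, hs, v, hvS, hv, ?_⟩
  have : f = s(s, v) := ((Sym2.mem_and_mem_iff hsv).1 ⟨hsf, hvf⟩)
  rw [this] at hfH
  exact hfH

/-- Two sets off a nonseparating `C` touch each other, or are joined by a connected set outside
everything. -/
lemma NonSep.link {V : Type} {H : SimpleGraph V} {C : Set (Sym2 V)} (hC : NonSep H C)
    {VC I J : Set V} (hVC : ∀ v, v ∈ VC ↔ ∃ g ∈ C, v ∈ g) (hI : Disjoint I VC)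
    (hJ : Disjoint J VC) (hIJ : Disjoint I J)
    {a b : V} (ha : a ∈ I) (hab : H.Adj a b) {c d : V} (hc : c ∈ J) (hcd : H.Adj c d) :
    Touches H I J ∨ ∃ T, (H.induce T).Connected ∧ Disjoint T (VC ∪ I ∪ J) ∧
      Touches H T I ∧ Touches H T J := by
  by_cases hIJt : Touches H I J
  · exact Or.inl hIJt
  right
  by_contra hno
  set Θ := VC ∪ I ∪ J with hΘ
  set S : Set V := I ∪ {z | ∃ w, w ∉ Θ ∧ (∃ i ∈ I, H.Adj w i) ∧ z ∈ reachAvoiding H Θ w} with hSdef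
  have key : ∀ s ∈ S, ∀ z ∈ J, ¬ H.Adj s z := by
    rintro s (hs | ⟨w, hw, ⟨i, hi, hwi⟩, hs⟩) z hz hsz
    · exact hIJt ⟨s, hs, z, hz, hsz⟩
    · exact hno ⟨_, connected_reachAvoiding hw,
        Set.disjoint_left.2 fun x hx => notMem_of_mem_reachAvoiding hx,
        ⟨w, mem_reachAvoiding_self hw, i, hi, hwi⟩, ⟨s, hs, z, hz, hsz⟩⟩
  have hSC : ∀ s ∈ S, s ∉ VC ∧ s ∉ J := by
    rintro s (hs | ⟨w, -, -, hs⟩)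
    · exact ⟨Set.disjoint_left.1 hI hs, Set.disjoint_left.1 hIJ hs⟩
    · have := notMem_of_mem_reachAvoiding hs
      simp only [hΘ, Set.mem_union, not_or] at this
      exact ⟨this.1.1, this.2⟩
  obtain ⟨s, hs, z, hzS, hz, hsz⟩ := hC.exists_adj (S := S) (a := a) (b := b) (g := s(c, d))
    (fun s hs g hg hsg => (hSC s hs).1 ((hVC s).2 ⟨g, hg, hsg⟩)) (Or.inl ha) hab hcd
    (fun h => Set.disjoint_left.1 hJ hc ((hVC c).2 ⟨_, h, by simp⟩))
    (by
      intro s hs hscd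
      rcases Sym2.mem_iff.1 hscd with rfl | rfl
      · exact (hSC s hs).2 hc
      · exact key s hs c hc hcd.symm)
  have hzVC : z ∉ VC := fun h => by
    obtain ⟨g, hg, hzg⟩ := (hVC z).1 h
    exact hz g hg hzg
  have hzJ : z ∉ J := fun h => key s hs z h hsz
  have hzI : z ∉ I := fun h => hzS (Or.inl h)
  have hzΘ : z ∉ Θ := by simp [hΘ, hzVC, hzJ, hzI]
  rcases hs with hs | ⟨w, hw, hi, hs⟩
  · exact hzS (Or.inr ⟨z, hzΘ, ⟨s, hs, hsz.symm⟩, mem_reachAvoiding_self hzΘ⟩)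
  · exact hzS (Or.inr ⟨w, hw, hi, mem_reachAvoiding_of_adj hs hzΘ hsz⟩)

/-- The vertices of a walk other than its two ends. -/
def innerVertices {V : Type} {H : SimpleGraph V} {u v : V} (q : H.Walk u v) : Set V :=
  {w | w ∈ q.support ∧ w ≠ u ∧ w ≠ v}

lemma exists_eq_cons_concat {V : Type} {H : SimpleGraph V} {u v : V} (q : H.Walk u v)
    (h : 2 ≤ q.length) : ∃ (a b : V) (h₁ : H.Adj u a) (r : H.Walk a b) (h₂ : H.Adj b v),
      q = Walk.cons h₁ (r.concat h₂) := by
  cases q with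
  | nil => simp at h
  | cons h₁ p =>
    cases p with
    | nil => simp at h
    | cons h' p =>
      obtain ⟨b, r, h₂, e⟩ := Walk.exists_cons_eq_concat h' p
      exact ⟨_, b, h₁, r, h₂, by rw [e]⟩

lemma innerVertices_spec {V : Type} {H : SimpleGraph V} {u v : V} {q : H.Walk u v} (hq : q.IsPath)
    (h : 2 ≤ q.length) : (H.induce (innerVertices q)).Connected ∧ Touches H {u} (innerVertices q) ∧
      Touches H {v} (innerVertices q) := by
  obtain ⟨a, b, h₁, r, h₂, rfl⟩ := exists_eq_cons_concat q h
  have hI : innerVertices (Walk.cons h₁ (r.concat h₂)) = {w | w ∈ r.support} := by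
    rw [Walk.cons_isPath_iff, Walk.concat_isPath_iff] at hq
    obtain ⟨⟨hr, hv⟩, hu⟩ := hq
    ext w
    simp only [innerVertices, Walk.support_cons, Walk.support_concat,
      List.mem_cons, List.mem_append, Set.mem_ofPred_eq] at hu ⊢
    constructor
    · rintro ⟨hw, hwu, hwv⟩
      simpa [hwu, hwv] using hw
    · intro hw
      refine ⟨Or.inr (Or.inl hw), ?_, ?_⟩
      · rintro rfl; exact hu (Or.inl hw)
      · rintro rfl; exact hv hw
  rw [hI]
  exact ⟨r.connected_induce_support, ⟨u, rfl, a, r.start_mem_support, h₁⟩,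
    ⟨v, rfl, b, r.end_mem_support, h₂.symm⟩⟩

lemma two_le_length_of_mem_innerVertices {V : Type} {H : SimpleGraph V} {u v w : V} {q : H.Walk u v}
    (hw : w ∈ innerVertices q) : 2 ≤ q.length := by
  obtain ⟨hw, hu, hv⟩ := hw
  cases q with
  | nil => simp_all
  | cons h p =>
    cases p with
    | nil => simp_all
    | cons h' p => simp

/-- The edges of two walks with the same ends. -/
def thetaEdges {V : Type} {H : SimpleGraph V} {u v : V} (p q : H.Walk u v) : Set (Sym2 V) :=
  {g | g ∈ p.edges ∨ g ∈ q.edges}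

lemma mem_support_iff_thetaEdges {V : Type} {H : SimpleGraph V} {u v : V} (huv : u ≠ v)
    (p q : H.Walk u v) (w : V) :
    w ∈ {w | w ∈ p.support ∨ w ∈ q.support} ↔ ∃ g ∈ thetaEdges p q, w ∈ g := by
  have hp : ¬ p.Nil := Walk.not_nil_of_ne huv
  have hq : ¬ q.Nil := Walk.not_nil_of_ne huv
  simp only [Set.mem_ofPred_eq, Walk.mem_support_iff_exists_mem_edges_of_not_nil hp,
    Walk.mem_support_iff_exists_mem_edges_of_not_nil hq, thetaEdges]
  grind

lemma mem_support_of_mem_edge {V : Type} {H : SimpleGraph V} {u v w : V} {p : H.Walk u v}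
    {g : Sym2 V} (hg : g ∈ p.edges) (hw : w ∈ g) : w ∈ p.support := by
  rw [Walk.mem_support_iff_exists_mem_edges]
  exact Or.inr ⟨g, hg, hw⟩

/-- In a theta graph two of whose cycles are nonseparating, no edge leaves the path common to these
two cycles, unless there is a `K₃,₃` minor. -/
lemma mem_edges_of_mem_innerVertices {V : Type} {H : SimpleGraph V} {u v : V} (huv : u ≠ v)
    {P q₁ q₂ : H.Walk u v} (hP : P.IsPath) (h₁ : q₁.IsPath) (h₂ : q₂.IsPath)
    (l₁ : 2 ≤ q₁.length) (l₂ : 2 ≤ q₂.length)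
    (d₁ : Disjoint (innerVertices P) (innerVertices q₁)) (d₂ : Disjoint (innerVertices P) (innerVertices q₂))
    (d : Disjoint (innerVertices q₁) (innerVertices q₂))
    (n₁ : NonSep H (thetaEdges P q₁)) (n₂ : NonSep H (thetaEdges P q₂))
    (hH : ¬ IsMinor (completeBipartiteGraph (Fin 3) (Fin 3)) H)
    {w z : V} (hw : w ∈ innerVertices P) (hwz : H.Adj w z) : s(w, z) ∈ P.edges := by
  by_contra hf
  have lP := two_le_length_of_mem_innerVertices hw
  obtain ⟨cP, uP, vP⟩ := innerVertices_spec hP lP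
  obtain ⟨c₁, u₁, v₁⟩ := innerVertices_spec h₁ l₁
  obtain ⟨c₂, u₂, v₂⟩ := innerVertices_spec h₂ l₂
  have chord : ∀ {q q' : H.Walk u v}, NonSep H (thetaEdges P q) → Disjoint (innerVertices P) (innerVertices q)
      → Disjoint (innerVertices P) (innerVertices q') → Disjoint (innerVertices q) (innerVertices q') →
      Touches H {u} (innerVertices q') → z ∈ {w | w ∈ P.support ∨ w ∈ q.support} → False := by
    intro q q' n dq dq' dqq' ⟨a, ha, b, hb, hab⟩ hz
    have hwq : w ∉ q.support := fun h =>
      Set.disjoint_left.1 dq hw ⟨h, hw.2⟩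
    have hbPq : b ∉ {w | w ∈ P.support ∨ w ∈ q.support} := by
      rintro (h | h)
      · exact Set.disjoint_left.1 dq' ⟨h, hb.2⟩ hb
      · exact Set.disjoint_left.1 dqq' ⟨h, hb.2⟩ hb
    have hw' : w ∈ {w | w ∈ P.support ∨ w ∈ q.support} := Or.inl hw.1
    have := n.eq_of_chord hwz ?_ ((mem_support_iff_thetaEdges huv P q w).1 hw')
      ((mem_support_iff_thetaEdges huv P q z).1 hz) (g := s(a, b)) hab ?_
    · have hb' : b ∈ s(w, z) := this ▸ (by simp)
      rcases Sym2.mem_iff.1 hb' with rfl | rfl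
      · exact hbPq hw'
      · exact hbPq hz
    · rintro (h | h)
      · exact hf h
      · exact hwq (q.fst_mem_support_of_mem_edges h)
    · intro h
      exact hbPq ((mem_support_iff_thetaEdges huv P q b).2 ⟨_, h, by simp⟩)
  set Θ : Set V := {x | x ∈ P.support ∨ x ∈ q₁.support ∨ x ∈ q₂.support} with hΘ
  by_cases hz : z ∈ Θ
  · rcases hz with hz | hz | hz
    · exact chord n₁ d₁ d₂ d u₂ (Or.inl hz)
    · exact chord n₁ d₁ d₂ d u₂ (Or.inr hz)
    · exact chord n₂ d₂ d₁ d.symm u₁ (Or.inr hz)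
  have link : ∀ {q q' : H.Walk u v}, NonSep H (thetaEdges P q) → Touches H {u} (innerVertices q') →
      (∀ x, x ∈ Θ ↔ x ∈ P.support ∨ x ∈ q.support ∨ x ∈ q'.support) →
      Disjoint (innerVertices P) (innerVertices q') → Disjoint (innerVertices q) (innerVertices q') →
      Touches H (reachAvoiding H Θ z) (innerVertices q') := by
    intro q q' n ⟨a, ha, b, hb, hab⟩ hΘ' dq' dqq'
    have hSΘ : ∀ s ∈ reachAvoiding H Θ z, s ∉ Θ := fun s hs => notMem_of_mem_reachAvoiding hs
    have hS : ∀ s ∈ reachAvoiding H Θ z, ∀ g ∈ thetaEdges P q, s ∉ g := by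
      intro s hs g hg hsg
      rcases (mem_support_iff_thetaEdges huv P q s).2 ⟨g, hg, hsg⟩ with h | h
      · exact hSΘ s hs ((hΘ' s).2 (Or.inl h))
      · exact hSΘ s hs ((hΘ' s).2 (Or.inr (Or.inl h)))
    have habC : s(a, b) ∉ thetaEdges P q := by
      intro h
      rcases (mem_support_iff_thetaEdges huv P q b).2 ⟨_, h, by simp⟩ with h | h
      · exact Set.disjoint_left.1 dq' ⟨h, hb.2⟩ hb
      · exact Set.disjoint_left.1 dqq' ⟨h, hb.2⟩ hb
    have habS : ∀ s ∈ reachAvoiding H Θ z, s ∉ s(a, b) := by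
      intro s hs h
      rcases Sym2.mem_iff.1 h with rfl | rfl
      · rw [Set.mem_singleton_iff] at ha
        subst ha
        exact hSΘ _ hs ((hΘ' _).2 (Or.inl P.start_mem_support))
      · exact hSΘ _ hs ((hΘ' _).2 (Or.inr (Or.inr hb.1)))
    obtain ⟨s, hs, y, hyS, hy, hsy⟩ := n.exists_adj hS (mem_reachAvoiding_self hz) hwz.symm
      (g := s(a, b)) hab habC habS
    refine ⟨s, hs, y, ?_, hsy⟩
    have hyPq : y ∉ {w | w ∈ P.support ∨ w ∈ q.support} := fun h => by
      obtain ⟨g, hg, hyg⟩ := (mem_support_iff_thetaEdges huv P q y).1 h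
      exact hy g hg hyg
    have hyΘ : y ∈ Θ := by
      by_contra h
      exact hyS (mem_reachAvoiding_of_adj hs h hsy)
    rcases (hΘ' y).1 hyΘ with h | h | h
    · exact absurd (Or.inl h) hyPq
    · exact absurd (Or.inr h) hyPq
    · refine ⟨h, ?_, ?_⟩
      · rintro rfl; exact hyPq (Or.inl P.start_mem_support)
      · rintro rfl; exact hyPq (Or.inl P.end_mem_support)
  have disj : ∀ {q : H.Walk u v}, (∀ x ∈ q.support, x ∈ Θ) →
      Disjoint (reachAvoiding H Θ z) (innerVertices q) := fun hq =>
    Set.disjoint_left.2 fun x hx hxq => notMem_of_mem_reachAvoiding hx (hq x hxq.1)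
  refine hH (isMinor_of_theta huv cP c₁ c₂ (connected_reachAvoiding hz) uP u₁ u₂ vP v₁ v₂
    ⟨z, mem_reachAvoiding_self hz, w, hw, hwz.symm⟩
    (link n₂ u₁ (fun x => by simp only [hΘ, Set.mem_ofPred_eq]; tauto) d₁ d.symm)
    (link n₁ u₂ (fun x => Iff.rfl) d₂ d) d₁ d₂ d
    (disj fun x hx => Or.inl hx) (disj fun x hx => Or.inr (Or.inl hx))
    (disj fun x hx => Or.inr (Or.inr hx)) ?_ ?_ ?_ ?_ ?_ ?_ ?_ ?_)
  · exact fun h => h.2.1 rfl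
  · exact fun h => h.2.1 rfl
  · exact fun h => h.2.1 rfl
  · exact fun h => h.2.2 rfl
  · exact fun h => h.2.2 rfl
  · exact fun h => h.2.2 rfl
  · exact fun h => notMem_of_mem_reachAvoiding h (Or.inl P.start_mem_support)
  · exact fun h => notMem_of_mem_reachAvoiding h (Or.inl P.end_mem_support)

lemma NonSep.exists_connected_union {V : Type} {H : SimpleGraph V} {u v : V} (huv : u ≠ v)
    {P q q₁ q₂ : H.Walk u v} (n : NonSep H (thetaEdges P q)) (h₁ : q₁.IsPath) (h₂ : q₂.IsPath)
    (l₁ : 2 ≤ q₁.length) (l₂ : 2 ≤ q₂.length)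
    (dP₁ : Disjoint (innerVertices P) (innerVertices q₁))
    (dP₂ : Disjoint (innerVertices P) (innerVertices q₂))
    (dq₁ : Disjoint (innerVertices q) (innerVertices q₁))
    (dq₂ : Disjoint (innerVertices q) (innerVertices q₂))
    (d₁₂ : Disjoint (innerVertices q₁) (innerVertices q₂)) :
    ∃ T : Set V, (∀ x ∈ T, x ∉ P.support ∧ x ∉ q.support ∧ x ∉ q₁.support ∧ x ∉ q₂.support) ∧
      (H.induce (innerVertices q₁ ∪ T)).Connected ∧
      Touches H (innerVertices q₁ ∪ T) (innerVertices q₂) ∧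
      (T.Nonempty → (H.induce T).Connected ∧ Touches H T (innerVertices q₁) ∧
        Touches H T (innerVertices q₂)) := by
  obtain ⟨c₁, ⟨a, ha, b, hb, hab⟩, -⟩ := innerVertices_spec h₁ l₁
  obtain ⟨c₂, ⟨c, hc, d, hd, hcd⟩, -⟩ := innerVertices_spec h₂ l₂
  have dis : ∀ {r : H.Walk u v}, Disjoint (innerVertices P) (innerVertices r) →
      Disjoint (innerVertices q) (innerVertices r) →
      Disjoint (innerVertices r) {w | w ∈ P.support ∨ w ∈ q.support} := by
    intro r h h'
    rw [Set.disjoint_left]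
    rintro x hx (hxP | hxq)
    · exact Set.disjoint_left.1 h ⟨hxP, hx.2⟩ hx
    · exact Set.disjoint_left.1 h' ⟨hxq, hx.2⟩ hx
  rcases n.link (mem_support_iff_thetaEdges huv P q) (dis dP₁ dq₁) (dis dP₂ dq₂) d₁₂ hb hab.symm
    hd hcd.symm with h | ⟨T, hT, hd, t₁, t₂⟩
  · exact ⟨∅, by simp, by rwa [Set.union_empty], by rwa [Set.union_empty], by simp⟩
  · refine ⟨T, fun x hx => ?_, connected_union_of_touches c₁ hT t₁.symm,
      t₂.mono Set.subset_union_right subset_rfl, fun _ => ⟨hT, t₁, t₂⟩⟩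
    have hx' := Set.disjoint_left.1 hd hx
    simp only [Set.mem_union, Set.mem_ofPred_eq, not_or, innerVertices, not_and, not_not] at hx'
    obtain ⟨⟨⟨hP, hq⟩, hx₁⟩, hx₂⟩ := hx'
    have hxu : x ≠ u := by rintro rfl; exact hP P.start_mem_support
    have hxv : x ≠ v := by rintro rfl; exact hP P.end_mem_support
    exact ⟨hP, hq, fun h => hxv (hx₁ h hxu), fun h => hxv (hx₂ h hxu)⟩

/-- Four internally disjoint paths with common ends, such that the first one forms a nonseparating
cycle with each of the other three, yield a Kuratowski minor. -/
lemma isMinor_of_three_nonSep {V : Type} {H : SimpleGraph V} {u v : V} (huv : u ≠ v)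
    {P q₁ q₂ q₃ : H.Walk u v} (hP : P.IsPath) (h₁ : q₁.IsPath) (h₂ : q₂.IsPath) (h₃ : q₃.IsPath)
    (l₁ : 2 ≤ q₁.length) (l₂ : 2 ≤ q₂.length) (l₃ : 2 ≤ q₃.length)
    (dP₁ : Disjoint (innerVertices P) (innerVertices q₁))
    (dP₂ : Disjoint (innerVertices P) (innerVertices q₂))
    (dP₃ : Disjoint (innerVertices P) (innerVertices q₃))
    (d₁₂ : Disjoint (innerVertices q₁) (innerVertices q₂))
    (d₁₃ : Disjoint (innerVertices q₁) (innerVertices q₃))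
    (d₂₃ : Disjoint (innerVertices q₂) (innerVertices q₃))
    (n₁ : NonSep H (thetaEdges P q₁)) (n₂ : NonSep H (thetaEdges P q₂))
    (n₃ : NonSep H (thetaEdges P q₃)) :
    IsMinor (completeGraph (Fin 5)) H ∨ IsMinor (completeBipartiteGraph (Fin 3) (Fin 3)) H := by
  obtain ⟨c₁, u₁, v₁⟩ := innerVertices_spec h₁ l₁
  obtain ⟨c₂, u₂, v₂⟩ := innerVertices_spec h₂ l₂
  obtain ⟨c₃, u₃, v₃⟩ := innerVertices_spec h₃ l₃
  obtain ⟨A, hA, cA, tA, kA⟩ := n₃.exists_connected_union huv h₁ h₂ l₁ l₂ dP₁ dP₂ d₁₃.symm d₂₃.symm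
    d₁₂
  obtain ⟨B, hB, cB, tB, kB⟩ := n₁.exists_connected_union huv h₂ h₃ l₂ l₃ dP₂ dP₃ d₁₂ d₁₃ d₂₃
  obtain ⟨C, hC, cC, tC, kC⟩ := n₂.exists_connected_union huv h₃ h₁ l₃ l₁ dP₃ dP₁ d₂₃ d₁₂.symm
    d₁₃.symm
  have theta : ∀ {S : Set V}, (H.induce S).Connected → Touches H S (innerVertices q₁) →
      Touches H S (innerVertices q₂) → Touches H S (innerVertices q₃) →
      (∀ x ∈ S, x ∉ P.support ∧ x ∉ q₁.support ∧ x ∉ q₂.support ∧ x ∉ q₃.support) →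
      IsMinor (completeBipartiteGraph (Fin 3) (Fin 3)) H := fun {S} hS t₁ t₂ t₃ h =>
    isMinor_of_theta huv c₁ c₂ c₃ hS u₁ u₂ u₃ v₁ v₂ v₃ t₁ t₂ t₃ d₁₂ d₁₃ d₂₃
      (Set.disjoint_left.2 fun x hx hxq => (h x hx).2.1 hxq.1)
      (Set.disjoint_left.2 fun x hx hxq => (h x hx).2.2.1 hxq.1)
      (Set.disjoint_left.2 fun x hx hxq => (h x hx).2.2.2 hxq.1)
      (fun h => h.2.1 rfl) (fun h => h.2.1 rfl) (fun h => h.2.1 rfl)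
      (fun h => h.2.2 rfl) (fun h => h.2.2 rfl) (fun h => h.2.2 rfl)
      (fun hu => (h u hu).1 P.start_mem_support) (fun hv => (h v hv).1 P.end_mem_support)
  have merge : ∀ {X Y : Set V} {x : V}, x ∈ X → x ∈ Y → (H.induce X).Connected →
      (H.induce Y).Connected → (H.induce (X ∪ Y)).Connected := fun hx hy cX cY =>
    induce_union_connected cX.preconnected cY.preconnected ⟨_, hx, hy⟩
  by_cases hAB : Disjoint A B
  swap
  · obtain ⟨x, hxA, hxB⟩ := Set.not_disjoint_iff.1 hAB
    obtain ⟨kA, tA₁, tA₂⟩ := kA ⟨x, hxA⟩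
    obtain ⟨kB, tB₁, tB₂⟩ := kB ⟨x, hxB⟩
    refine Or.inr (theta (merge hxA hxB kA kB) (tA₁.mono Set.subset_union_left subset_rfl)
      (tA₂.mono Set.subset_union_left subset_rfl) (tB₂.mono Set.subset_union_right subset_rfl) ?_)
    rintro y (hy | hy)
    · have := hA y hy; tauto
    · have := hB y hy; tauto
  by_cases hBC : Disjoint B C
  swap
  · obtain ⟨x, hxB, hxC⟩ := Set.not_disjoint_iff.1 hBC
    obtain ⟨kB, tB₁, tB₂⟩ := kB ⟨x, hxB⟩
    obtain ⟨kC, tC₁, tC₂⟩ := kC ⟨x, hxC⟩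
    refine Or.inr (theta (merge hxB hxC kB kC) (tC₂.mono Set.subset_union_right subset_rfl)
      (tB₁.mono Set.subset_union_left subset_rfl) (tB₂.mono Set.subset_union_left subset_rfl) ?_)
    rintro y (hy | hy)
    · have := hB y hy; tauto
    · have := hC y hy; tauto
  by_cases hAC : Disjoint A C
  swap
  · obtain ⟨x, hxA, hxC⟩ := Set.not_disjoint_iff.1 hAC
    obtain ⟨kA, tA₁, tA₂⟩ := kA ⟨x, hxA⟩
    obtain ⟨kC, tC₁, tC₂⟩ := kC ⟨x, hxC⟩
    refine Or.inr (theta (merge hxA hxC kA kC) (tA₁.mono Set.subset_union_left subset_rfl)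
      (tA₂.mono Set.subset_union_left subset_rfl) (tC₁.mono Set.subset_union_right subset_rfl) ?_)
    rintro y (hy | hy)
    · have := hA y hy; tauto
    · have := hC y hy; tauto
  left
  obtain ⟨w, r, hwv, rfl⟩ : ∃ w, ∃ (r : H.Walk u w) (hwv : H.Adj w v), P = r.concat hwv := by
    cases P with
    | nil => exact absurd rfl huv
    | cons h p => exact Walk.exists_cons_eq_concat h p
  have hrP : ∀ x, x ∈ r.support → x ∈ (r.concat hwv).support := fun x hx => by
    simp [Walk.support_concat, hx]
  have hvr : v ∉ r.support := (Walk.concat_isPath_iff hwv |>.1 hP).2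
  have hvP : v ∈ (r.concat hwv).support := Walk.end_mem_support _
  have rI : ∀ {q : H.Walk u v}, Disjoint (innerVertices (r.concat hwv)) (innerVertices q) →
      ∀ x ∈ r.support, x ∉ innerVertices q := fun {q} hd x hx hxq =>
    Set.disjoint_left.1 hd ⟨hrP x hx, hxq.2⟩ hxq
  have uT : ∀ {q : H.Walk u v} {T : Set V}, Touches H {u} (innerVertices q) →
      Touches H {x | x ∈ r.support} (innerVertices q ∪ T) := fun h =>
    h.mono (by rintro _ rfl; exact r.start_mem_support) Set.subset_union_left
  have vT : ∀ {q : H.Walk u v} {T : Set V}, Touches H {v} (innerVertices q) →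
      Touches H {v} (innerVertices q ∪ T) := fun h =>
    h.mono subset_rfl Set.subset_union_left
  have IT : ∀ {q : H.Walk u v} {T : Set V}, (∀ x ∈ T, x ∉ q.support) →
      Disjoint (innerVertices q) T := fun h =>
    Set.disjoint_left.2 fun x hx hxT => h x hxT hx.1
  refine isMinor_completeGraph_five (A := {x | x ∈ r.support}) (B := {v})
    (C := innerVertices q₁ ∪ A) (D := innerVertices q₂ ∪ B) (E := innerVertices q₃ ∪ C)
    r.connected_induce_support (connected_singleton v) cA cB cC ?_ ?_ ?_ ?_ ?_ ?_ ?_ ?_ ?_ ?_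
    ⟨w, r.end_mem_support, v, rfl, hwv⟩ (uT u₁) (uT u₂) (uT u₃) (vT v₁) (vT v₂) (vT v₃)
    (tA.mono subset_rfl Set.subset_union_left)
    (tC.mono subset_rfl Set.subset_union_left).symm
    (tB.mono subset_rfl Set.subset_union_left)
  · exact Set.disjoint_singleton_right.2 hvr
  · rw [Set.disjoint_left]
    rintro x hx (hx' | hx')
    · exact rI dP₁ x hx hx'
    · exact (hA x hx').1 (hrP x hx)
  · rw [Set.disjoint_left]
    rintro x hx (hx' | hx')
    · exact rI dP₂ x hx hx'
    · exact (hB x hx').1 (hrP x hx)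
  · rw [Set.disjoint_left]
    rintro x hx (hx' | hx')
    · exact rI dP₃ x hx hx'
    · exact (hC x hx').1 (hrP x hx)
  · rw [Set.disjoint_singleton_left]
    rintro (h | h)
    · exact h.2.2 rfl
    · exact (hA v h).1 hvP
  · rw [Set.disjoint_singleton_left]
    rintro (h | h)
    · exact h.2.2 rfl
    · exact (hB v h).1 hvP
  · rw [Set.disjoint_singleton_left]
    rintro (h | h)
    · exact h.2.2 rfl
    · exact (hC v h).1 hvP
  · rw [Set.disjoint_union_left, Set.disjoint_union_right, Set.disjoint_union_right]
    exact ⟨⟨d₁₂, IT fun x hx => (hB x hx).2.1⟩, (IT fun x hx => (hA x hx).2.2.2).symm, hAB⟩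
  · rw [Set.disjoint_union_left, Set.disjoint_union_right, Set.disjoint_union_right]
    exact ⟨⟨d₁₃, IT fun x hx => (hC x hx).2.2.2⟩, (IT fun x hx => (hA x hx).2.1).symm, hAC⟩
  · rw [Set.disjoint_union_left, Set.disjoint_union_right, Set.disjoint_union_right]
    exact ⟨⟨d₂₃, IT fun x hx => (hC x hx).2.1⟩, (IT fun x hx => (hB x hx).2.2.2).symm, hBC⟩

/-- The total weight of the edges of a walk. -/
noncomputable def walkLen {V : Type} {H : SimpleGraph V} (ℓ : Sym2 V → ℝ) {u v : V}
    (p : H.Walk u v) : ℝ :=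
  (p.edges.map ℓ).sum

lemma walkLen_append {V : Type} {H : SimpleGraph V} (ℓ : Sym2 V → ℝ) {u v w : V}
    (p : H.Walk u v) (q : H.Walk v w) : walkLen ℓ (p.append q) = walkLen ℓ p + walkLen ℓ q := by
  simp [walkLen, Walk.edges_append]

lemma walkLen_cons {V : Type} {H : SimpleGraph V} (ℓ : Sym2 V → ℝ) {u v w : V}
    (h : H.Adj u v) (q : H.Walk v w) : walkLen ℓ (Walk.cons h q) = ℓ s(u, v) + walkLen ℓ q := by
  simp [walkLen]

lemma walkLen_reverse {V : Type} {H : SimpleGraph V} (ℓ : Sym2 V → ℝ) {u v : V}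
    (p : H.Walk u v) : walkLen ℓ p.reverse = walkLen ℓ p := by
  simp [walkLen]

lemma walkLen_nonneg {V : Type} {H : SimpleGraph V} {ℓ : Sym2 V → ℝ} (hℓ : ∀ g, 0 ≤ ℓ g) {u v : V}
    (p : H.Walk u v) : 0 ≤ walkLen ℓ p :=
  List.sum_nonneg (by simpa using fun g _ => hℓ g)

lemma sum_map_le_of_subset {α : Type} {ℓ : α → ℝ} (hℓ : ∀ g, 0 ≤ ℓ g) {l l' : List α}
    (hl : l.Nodup) (h : l ⊆ l') : (l.map ℓ).sum ≤ (l'.map ℓ).sum := by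
  obtain ⟨m, hm, hm'⟩ := hl.subperm h
  rw [← (hm.map ℓ).sum_eq]
  exact (hm'.map ℓ).sum_le_sum (by simpa using fun g _ => hℓ g)

/-- Every cycle has weight at least one. -/
def CycleBound {V : Type} (H : SimpleGraph V) (ℓ : Sym2 V → ℝ) : Prop :=
  ∀ ⦃v : V⦄ (c : H.Walk v v), c.IsCycle → 1 ≤ walkLen ℓ c

lemma CycleBound.one_le_add {V : Type} {H : SimpleGraph V} {ℓ : Sym2 V → ℝ}
    (hH : CycleBound H ℓ) (hℓ : ∀ g, 0 ≤ ℓ g) {u v : V} {r s : H.Walk u v} (hr : r.IsPath)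
    (hs : s.IsPath) (hrs : r ≠ s) : 1 ≤ walkLen ℓ r + walkLen ℓ s := by
  set J := fromEdgeSet {g | g ∈ r.edges ∨ g ∈ s.edges} with hJ
  have hr' : ∀ g ∈ r.edges, g ∈ J.edgeSet := fun g hg => by
    rw [hJ, edgeSet_fromEdgeSet]
    exact ⟨Or.inl hg, H.not_isDiag_of_mem_edgeSet (r.edges_subset_edgeSet hg)⟩
  have hs' : ∀ g ∈ s.edges, g ∈ J.edgeSet := fun g hg => by
    rw [hJ, edgeSet_fromEdgeSet]
    exact ⟨Or.inr hg, H.not_isDiag_of_mem_edgeSet (s.edges_subset_edgeSet hg)⟩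
  have hac : ¬ J.IsAcyclic := by
    intro hac
    have h := (hac.subsingleton_path u v).elim ⟨_, hr.transfer hr'⟩ ⟨_, hs.transfer hs'⟩
    have h' : r.transfer J hr' = s.transfer J hs' := congrArg Subtype.val h
    have h2 := congrArg Walk.support h'
    rw [Walk.support_transfer, Walk.support_transfer] at h2
    exact hrs (Walk.ext_support h2)
  simp only [IsAcyclic, not_forall, not_not] at hac
  obtain ⟨w, c, hc⟩ := hac
  have hJe : ∀ g ∈ c.edges, g ∈ r.edges ∨ g ∈ s.edges := fun g hg => by
    have := c.edges_subset_edgeSet hg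
    rw [hJ, edgeSet_fromEdgeSet] at this
    exact this.1
  have hcH : ∀ g ∈ c.edges, g ∈ H.edgeSet := fun g hg =>
    (hJe g hg).elim (fun h => r.edges_subset_edgeSet h) fun h => s.edges_subset_edgeSet h
  have h1 := hH _ (hc.transfer hcH)
  refine h1.trans ?_
  rw [walkLen, Walk.edges_transfer, walkLen, walkLen, ← List.sum_append, ← List.map_append]
  exact sum_map_le_of_subset hℓ hc.edges_nodup fun g hg => List.mem_append.2 (hJe g hg)

/-- The path `p` closes the edge `s(x, y)` to a nonseparating cycle of weight one. -/
structure TightPath {V : Type} (H : SimpleGraph V) (ℓ : Sym2 V → ℝ) {x y : V}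
    (p : H.Walk x y) : Prop where
  isPath : p.IsPath
  notMem : s(x, y) ∉ p.edges
  len : walkLen ℓ p = 1 - ℓ s(x, y)
  nonSep : NonSep H {g | g = s(x, y) ∨ g ∈ p.edges}

lemma TightPath.reverse {V : Type} {H : SimpleGraph V} {ℓ : Sym2 V → ℝ} {x y : V}
    {p : H.Walk x y} (h : TightPath H ℓ p) : TightPath H ℓ p.reverse := by
  have e : s(y, x) = s(x, y) := Sym2.eq_swap
  refine ⟨h.isPath.reverse, ?_, ?_, ?_⟩
  · rw [e, Walk.edges_reverse, List.mem_reverse]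
    exact h.notMem
  · rw [e, walkLen_reverse, h.len]
  · simpa only [e, Walk.edges_reverse, List.mem_reverse] using h.nonSep

lemma TightPath.eq_or_eq {V : Type} {H : SimpleGraph V} {ℓ : Sym2 V → ℝ}
    (hH : CycleBound H ℓ) (hℓ : ∀ g, 0 ≤ ℓ g) {x y : V} (hpos : 0 < ℓ s(x, y))
    {u v w : V} {a : H.Walk x u} {b : H.Walk v y} {r₁ r₂ : H.Walk u w} {s₁ s₂ : H.Walk w v}
    (h₁ : TightPath H ℓ (a.append ((r₁.append s₁).append b)))
    (h₂ : TightPath H ℓ (a.append ((r₂.append s₂).append b))) : r₁ = r₂ ∨ s₁ = s₂ := by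
  by_contra! hne
  have p₁ := h₁.isPath.of_append_right.of_append_left
  have p₂ := h₂.isPath.of_append_right.of_append_left
  have k₁ := hH.one_le_add hℓ p₁.of_append_left p₂.of_append_left hne.1
  have k₂ := hH.one_le_add hℓ p₁.of_append_right p₂.of_append_right hne.2
  have m₁ := h₁.notMem
  have m₂ := h₂.notMem
  have e₁ := h₁.len
  have e₂ := h₂.len
  simp only [Walk.edges_append, List.mem_append, not_or] at m₁ m₂
  simp only [walkLen_append] at e₁ e₂
  have := walkLen_nonneg hℓ a
  have := walkLen_nonneg hℓ b
  linarith

lemma exists_common_prefix {V : Type} {H : SimpleGraph V} {x y : V} {p₁ p₂ : H.Walk x y}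
    (h₁ : p₁.IsPath) (h₂ : p₂.IsPath) (hne : p₁ ≠ p₂) :
    ∃ (u : V) (a : H.Walk x u) (r₁ r₂ : H.Walk u y), p₁ = a.append r₁ ∧ p₂ = a.append r₂ ∧
      r₁.snd ≠ r₂.snd := by
  induction p₁ with
  | nil => exact absurd (Walk.isPath_iff_nil.1 h₂).eq_nil.symm hne
  | @cons x z y h p ih =>
    cases p₂ with
    | nil => exact absurd (Walk.isPath_iff_nil.1 h₁).eq_nil hne
    | @cons _ z' _ h' p' =>
      by_cases hz : z = z'
      · subst hz
        obtain ⟨u, a, r₁, r₂, e₁, e₂, hs⟩ := ih h₁.of_cons h₂.of_cons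
          (fun e => hne (by rw [e]))
        exact ⟨u, Walk.cons h a, r₁, r₂, by rw [e₁, Walk.cons_append],
          by rw [e₂, Walk.cons_append], hs⟩
      · exact ⟨x, Walk.nil, _, _, rfl, rfl, by simpa using hz⟩

lemma snd_append_of_ne {V : Type} {H : SimpleGraph V} {u v y : V} (q : H.Walk u v) (b : H.Walk v y)
    (huv : u ≠ v) : (q.append b).snd = q.snd := by
  cases q with
  | nil => exact absurd rfl huv
  | cons h q => simp [Walk.cons_append]

lemma ne_of_snd_ne {V : Type} {H : SimpleGraph V} {u v : V} {q₁ q₂ : H.Walk u v}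
    (h₁ : q₁.IsPath) (h₂ : q₂.IsPath) (hs : q₁.snd ≠ q₂.snd) : u ≠ v := by
  rintro rfl
  rw [(Walk.isPath_iff_nil.1 h₁).eq_nil, (Walk.isPath_iff_nil.1 h₂).eq_nil] at hs
  exact hs rfl

lemma exists_common_prefix_suffix {V : Type} {H : SimpleGraph V} {x y : V} {p₁ p₂ : H.Walk x y}
    (h₁ : p₁.IsPath) (h₂ : p₂.IsPath) (hne : p₁ ≠ p₂) :
    ∃ (u v : V) (a : H.Walk x u) (q₁ q₂ : H.Walk u v) (b : H.Walk v y),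
      p₁ = a.append (q₁.append b) ∧ p₂ = a.append (q₂.append b) ∧
      q₁.snd ≠ q₂.snd ∧ q₁.reverse.snd ≠ q₂.reverse.snd := by
  obtain ⟨u, a, r₁, r₂, rfl, rfl, hs⟩ := exists_common_prefix h₁ h₂ hne
  have k₁ := h₁.of_append_right
  have k₂ := h₂.of_append_right
  obtain ⟨v, b, s₁, s₂, e₁, e₂, hs'⟩ := exists_common_prefix k₁.reverse k₂.reverse
    (fun h => hs (by rw [Walk.reverse_injective h]))
  have f₁ : r₁ = s₁.reverse.append b.reverse := by
    rw [← Walk.reverse_append, ← e₁, Walk.reverse_reverse]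
  have f₂ : r₂ = s₂.reverse.append b.reverse := by
    rw [← Walk.reverse_append, ← e₂, Walk.reverse_reverse]
  have huv : u ≠ v := (ne_of_snd_ne ((Walk.isPath_reverse_iff _).1 (f₁ ▸ k₁).of_append_left)
    ((Walk.isPath_reverse_iff _).1 (f₂ ▸ k₂).of_append_left) hs').symm
  refine ⟨u, v, a, s₁.reverse, s₂.reverse, b.reverse, by rw [f₁], by rw [f₂], ?_, by simpa using hs'⟩
  rwa [f₁, f₂, snd_append_of_ne _ _ huv, snd_append_of_ne _ _ huv] at hs

lemma eq_of_mem_support_append {V : Type} {H : SimpleGraph V} {u v y w : V} {q : H.Walk u v}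
    {b : H.Walk v y} (h : (q.append b).IsPath) (hq : w ∈ q.support) (hb : w ∈ b.support) :
    w = v := by
  by_contra hw
  exact h.ne_of_mem_support_of_append hw hq hb rfl

lemma notMem_support_of_append {V : Type} {H : SimpleGraph V} {x y u v : V} {a : H.Walk x u}
    {b : H.Walk v y} {q : H.Walk u v} (huv : u ≠ v) (h : (a.append (q.append b)).IsPath) :
    ∀ w ∈ a.support, w ∉ b.support := fun w ha hb => by
  have hu := eq_of_mem_support_append h ha (by simp [hb])
  subst hu
  exact huv (eq_of_mem_support_append h.of_append_right q.start_mem_support hb)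

/-- The path that goes from `u` back to `x`, along the edge `s(x, y)`, and from `y` back to `v`. -/
def outerPath {V : Type} {H : SimpleGraph V} {x y u v : V} (hxy : H.Adj x y) (a : H.Walk x u)
    (b : H.Walk v y) : H.Walk u v :=
  a.reverse.append (Walk.cons hxy b.reverse)

lemma mem_support_outerPath {V : Type} {H : SimpleGraph V} {x y u v w : V} (hxy : H.Adj x y)
    (a : H.Walk x u) (b : H.Walk v y) :
    w ∈ (outerPath hxy a b).support ↔ w ∈ a.support ∨ w ∈ b.support := by
  simp only [outerPath, Walk.mem_support_append_iff, Walk.support_reverse, List.mem_reverse,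
    Walk.support_cons, List.mem_cons]
  constructor
  · rintro (h | rfl | h)
    exacts [Or.inl h, Or.inl a.start_mem_support, Or.inr h]
  · rintro (h | h)
    exacts [Or.inl h, Or.inr (Or.inr h)]

lemma mem_edges_outerPath {V : Type} {H : SimpleGraph V} {x y u v : V} {g : Sym2 V}
    (hxy : H.Adj x y) (a : H.Walk x u) (b : H.Walk v y) :
    g ∈ (outerPath hxy a b).edges ↔ g ∈ a.edges ∨ g = s(x, y) ∨ g ∈ b.edges := by
  simp [outerPath, Walk.edges_append]

lemma outerPath_isPath {V : Type} {H : SimpleGraph V} {x y u v : V} (hxy : H.Adj x y)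
    {a : H.Walk x u} {b : H.Walk v y} {q : H.Walk u v} (huv : u ≠ v)
    (h : (a.append (q.append b)).IsPath) : (outerPath hxy a b).IsPath := by
  have hab := notMem_support_of_append huv h
  have hx : x ∉ b.reverse.support := by simpa using hab x a.start_mem_support
  have hc : (Walk.cons hxy b.reverse).IsPath :=
    (Walk.cons_isPath_iff _ _).2 ⟨h.of_append_right.of_append_right.reverse, hx⟩
  rw [outerPath, Walk.isPath_def, Walk.support_append, Walk.support_cons, List.tail_cons]
  refine List.Nodup.append h.of_append_left.reverse.support_nodup
    h.of_append_right.of_append_right.reverse.support_nodup ?_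
  intro w hw hw'
  exact hab w (by simpa using hw) (by simpa using hw')

lemma thetaEdges_outerPath {V : Type} {H : SimpleGraph V} {x y u v : V} (hxy : H.Adj x y)
    (a : H.Walk x u) (b : H.Walk v y) (q : H.Walk u v) :
    thetaEdges (outerPath hxy a b) q = {g | g = s(x, y) ∨ g ∈ (a.append (q.append b)).edges} := by
  ext g
  simp only [thetaEdges, Set.mem_ofPred_eq, mem_edges_outerPath, Walk.edges_append,
    List.mem_append]
  tauto

lemma disjoint_innerVertices_outerPath {V : Type} {H : SimpleGraph V} {x y u v : V}
    (hxy : H.Adj x y) {a : H.Walk x u} {b : H.Walk v y} {q : H.Walk u v}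
    (h : (a.append (q.append b)).IsPath) :
    Disjoint (innerVertices (outerPath hxy a b)) (innerVertices q) := by
  rw [Set.disjoint_left]
  rintro w ⟨hw, hwu, hwv⟩ ⟨hq, -, -⟩
  rcases (mem_support_outerPath hxy a b).1 hw with ha | hb
  · exact hwu (eq_of_mem_support_append h ha (by simp [hq]))
  · exact hwv (eq_of_mem_support_append h.of_append_right hq hb)

lemma TightPath.disjoint {V : Type} {H : SimpleGraph V} {ℓ : Sym2 V → ℝ}
    (hH : CycleBound H ℓ) (hℓ : ∀ g, 0 ≤ ℓ g) {x y : V} (hpos : 0 < ℓ s(x, y))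
    {u v : V} {a : H.Walk x u} {b : H.Walk v y} {q₁ q₂ : H.Walk u v}
    (h₁ : TightPath H ℓ (a.append (q₁.append b))) (h₂ : TightPath H ℓ (a.append (q₂.append b)))
    (hs : q₁.snd ≠ q₂.snd) (hp : q₁.reverse.snd ≠ q₂.reverse.snd) :
    Disjoint (innerVertices q₁) (innerVertices q₂) := by
  classical
  rw [Set.disjoint_left]
  rintro w ⟨hw₁, hwu, hwv⟩ ⟨hw₂, -, -⟩
  obtain ⟨r₁, s₁, rfl⟩ := Walk.mem_support_iff_exists_append.1 hw₁
  obtain ⟨r₂, s₂, rfl⟩ := Walk.mem_support_iff_exists_append.1 hw₂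
  rcases h₁.eq_or_eq hH hℓ hpos h₂ with rfl | rfl
  · rw [snd_append_of_ne _ _ hwu.symm, snd_append_of_ne _ _ hwu.symm] at hs
    exact hs rfl
  · rw [Walk.reverse_append, Walk.reverse_append, snd_append_of_ne _ _ hwv.symm,
      snd_append_of_ne _ _ hwv.symm] at hp
    exact hp rfl

lemma TightPath.two_le_length {V : Type} {H : SimpleGraph V} {ℓ : Sym2 V → ℝ}
    (hH : CycleBound H ℓ) (hℓ : ∀ g, 0 ≤ ℓ g) (hhalf : ∀ g ∈ H.edgeSet, ℓ g < 1 / 2) {x y : V}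
    {u v : V} {a : H.Walk x u} {b : H.Walk v y} {q₁ q₂ : H.Walk u v}
    (h₁ : TightPath H ℓ (a.append (q₁.append b))) (h₂ : TightPath H ℓ (a.append (q₂.append b)))
    (hs : q₁.snd ≠ q₂.snd) : 2 ≤ q₁.length := by
  have e₁ := h₁.len
  have e₂ := h₂.len
  simp only [walkLen_append] at e₁ e₂
  have := hH.one_le_add hℓ h₁.isPath.of_append_right.of_append_left
    h₂.isPath.of_append_right.of_append_left (fun h => hs (by rw [h]))
  cases q₁ with
  | nil =>
    simp only [walkLen, Walk.edges_nil, List.map_nil, List.sum_nil] at *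
    linarith
  | cons h q =>
    cases q with
    | nil =>
      have h3 := hhalf _ (H.mem_edgeSet.2 h)
      rw [walkLen_cons] at *
      simp only [walkLen, Walk.edges_nil, List.map_nil, List.sum_nil] at *
      linarith
    | cons h' q => simp

/-- The common part of two tight cycles is not touched by any other edge. -/
lemma TightPath.mem_edges_outerPath {V : Type} {H : SimpleGraph V} {ℓ : Sym2 V → ℝ}
    (hH : CycleBound H ℓ) (hℓ : ∀ g, 0 ≤ ℓ g) (hhalf : ∀ g ∈ H.edgeSet, ℓ g < 1 / 2)
    (hK : ¬ IsMinor (completeBipartiteGraph (Fin 3) (Fin 3)) H)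
    {x y : V} (hxy : H.Adj x y) (hpos : 0 < ℓ s(x, y))
    {u v : V} {a : H.Walk x u} {b : H.Walk v y} {q₁ q₂ : H.Walk u v}
    (h₁ : TightPath H ℓ (a.append (q₁.append b))) (h₂ : TightPath H ℓ (a.append (q₂.append b)))
    (hs : q₁.snd ≠ q₂.snd) (hp : q₁.reverse.snd ≠ q₂.reverse.snd)
    {w z : V} (hw : w ∈ innerVertices (outerPath hxy a b)) (hwz : H.Adj w z) :
    s(w, z) ∈ (outerPath hxy a b).edges := by
  have k₁ := h₁.isPath.of_append_right.of_append_left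
  have k₂ := h₂.isPath.of_append_right.of_append_left
  have huv := ne_of_snd_ne k₁ k₂ hs
  refine mem_edges_of_mem_innerVertices huv (outerPath_isPath hxy huv h₁.isPath) k₁ k₂
    (h₁.two_le_length hH hℓ hhalf h₂ hs) (h₂.two_le_length hH hℓ hhalf h₁ hs.symm)
    (disjoint_innerVertices_outerPath hxy h₁.isPath) (disjoint_innerVertices_outerPath hxy h₂.isPath)
    (h₁.disjoint hH hℓ hpos h₂ hs hp) ?_ ?_ hK hw hwz
  · rw [thetaEdges_outerPath]; exact h₁.nonSep
  · rw [thetaEdges_outerPath]; exact h₂.nonSep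

lemma exists_eq_append {V : Type} {H : SimpleGraph V} {x u y : V} {a : H.Walk x u}
    (ha : a.IsPath) {p : H.Walk x y} (hp : p.IsPath) (hy : y ∈ a.support → y = u)
    (h : ∀ w ∈ a.support, w ≠ u → ∀ g ∈ p.edges, w ∈ g → g ∈ a.edges) :
    ∃ r : H.Walk u y, p = a.append r := by
  induction a with
  | nil => exact ⟨p, rfl⟩
  | @cons x z u hxz a ih =>
    rw [Walk.cons_isPath_iff] at ha
    have hxu : x ≠ u := by rintro rfl; exact ha.2 a.end_mem_support
    cases p with
    | nil => exact absurd (hy (Walk.start_mem_support _)) hxu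
    | @cons _ z' _ h' p =>
      rw [Walk.cons_isPath_iff] at hp
      have h1 := h x (Walk.start_mem_support _) hxu s(x, z') (by simp) (by simp)
      rw [Walk.edges_cons, List.mem_cons] at h1
      rcases h1 with h1 | h1
      swap
      · exact absurd (a.fst_mem_support_of_mem_edges h1) ha.2
      have hz : z' = z := by simpa [hxz.ne] using h1
      subst hz
      obtain ⟨r, rfl⟩ := ih ha.1 hp.1 (fun h => hy (by simp [h])) fun w hw hwu g hg hwg => by
        have h2 := h w (by simp [hw]) hwu g (by simp [hg]) hwg
        rw [Walk.edges_cons, List.mem_cons] at h2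
        rcases h2 with rfl | h2
        · exact absurd (p.fst_mem_support_of_mem_edges hg) hp.2
        · exact h2
      exact ⟨r, by rw [Walk.cons_append]⟩

lemma TightPath.exists_eq_append_append {V : Type} {H : SimpleGraph V} {ℓ : Sym2 V → ℝ}
    (hH : CycleBound H ℓ) (hℓ : ∀ g, 0 ≤ ℓ g) (hhalf : ∀ g ∈ H.edgeSet, ℓ g < 1 / 2)
    (hK : ¬ IsMinor (completeBipartiteGraph (Fin 3) (Fin 3)) H)
    {x y : V} (hxy : H.Adj x y) (hpos : 0 < ℓ s(x, y))
    {u v : V} {a : H.Walk x u} {b : H.Walk v y} {q₁ q₂ : H.Walk u v}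
    (h₁ : TightPath H ℓ (a.append (q₁.append b))) (h₂ : TightPath H ℓ (a.append (q₂.append b)))
    (hs : q₁.snd ≠ q₂.snd) (hp : q₁.reverse.snd ≠ q₂.reverse.snd)
    {p : H.Walk x y} (h : TightPath H ℓ p) : ∃ q : H.Walk u v, p = a.append (q.append b) := by
  have huv := ne_of_snd_ne h₁.isPath.of_append_right.of_append_left
    h₂.isPath.of_append_right.of_append_left hs
  have hab := notMem_support_of_append huv h₁.isPath
  have key : ∀ w, w ∈ (outerPath hxy a b).support → w ≠ u → w ≠ v → ∀ g ∈ p.edges, w ∈ g →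
      g ∈ a.edges ∨ g ∈ b.edges := by
    intro w hw hwu hwv g hg hwg
    obtain ⟨z, rfl⟩ := hwg
    have := h₁.mem_edges_outerPath hH hℓ hhalf hK hxy hpos h₂ hs hp ⟨hw, hwu, hwv⟩
      (p.edges_subset_edgeSet hg)
    rw [_root_.mem_edges_outerPath] at this
    rcases this with h' | h' | h'
    · exact Or.inl h'
    · exact absurd (h' ▸ hg) h.notMem
    · exact Or.inr h'
  obtain ⟨r, rfl⟩ := exists_eq_append h₁.isPath.of_append_left h.isPath
    (fun hy => absurd b.end_mem_support (hab y hy)) fun w hw hwu g hg hwg => by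
      refine (key w ((mem_support_outerPath _ _ _).2 (Or.inl hw)) hwu ?_ g hg hwg).resolve_right ?_
      · rintro rfl; exact hab _ hw b.start_mem_support
      · exact fun hgb => hab w hw (mem_support_of_mem_edge hgb hwg)
  obtain ⟨r', hr'⟩ := exists_eq_append (a := b.reverse) (p := r.reverse)
    h₁.isPath.of_append_right.of_append_right.reverse h.isPath.of_append_right.reverse
    (fun hu => absurd (by simpa using hu) (hab u a.end_mem_support)) fun w hw hwv g hg hwg => by
      simp only [Walk.support_reverse, List.mem_reverse, Walk.edges_reverse] at hw hg ⊢
      refine (key w ((mem_support_outerPath _ _ _).2 (Or.inr hw)) ?_ hwv g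
        (by simp [Walk.edges_append, hg]) hwg).resolve_left ?_
      · rintro rfl; exact hab _ a.end_mem_support hw
      · exact fun hga => hab w (mem_support_of_mem_edge hga hwg) hw
  refine ⟨r'.reverse, ?_⟩
  rw [← Walk.reverse_reverse r, hr', Walk.reverse_append, Walk.reverse_reverse]

lemma snd_mem_innerVertices {V : Type} {H : SimpleGraph V} {u v : V} {q : H.Walk u v}
    (hq : q.IsPath) (h : 2 ≤ q.length) : q.snd ∈ innerVertices q ∧ s(u, q.snd) ∈ q.edges := by
  cases q with
  | nil => simp at h
  | @cons _ z _ h₁ q =>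
    cases q with
    | nil => simp at h
    | cons h₂ q =>
      refine ⟨⟨by simp, ?_, ?_⟩, by simp⟩
      · simpa using h₁.ne'
      · intro hzv
        rw [Walk.snd_cons] at hzv
        subst hzv
        have := Walk.isPath_iff_nil.1 hq.of_cons
        simp at this

lemma TightPath.snd_ne {V : Type} {H : SimpleGraph V} {ℓ : Sym2 V → ℝ}
    (hH : CycleBound H ℓ) (hℓ : ∀ g, 0 ≤ ℓ g) (hhalf : ∀ g ∈ H.edgeSet, ℓ g < 1 / 2)
    (hK : ¬ IsMinor (completeBipartiteGraph (Fin 3) (Fin 3)) H)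
    {x y : V} (hxy : H.Adj x y) (hpos : 0 < ℓ s(x, y))
    {u v : V} {a : H.Walk x u} {b : H.Walk v y} {q₁ q₂ q₃ : H.Walk u v}
    (h₁ : TightPath H ℓ (a.append (q₁.append b))) (h₂ : TightPath H ℓ (a.append (q₂.append b)))
    (h₃ : TightPath H ℓ (a.append (q₃.append b)))
    (hs : q₁.snd ≠ q₂.snd) (hp : q₁.reverse.snd ≠ q₂.reverse.snd) (h₁₃ : q₁ ≠ q₃) :
    q₁.snd ≠ q₃.snd := by
  intro hs₁₃
  have k₁ := h₁.isPath.of_append_right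
  have k₂ := h₂.isPath.of_append_right
  have k₃ := h₃.isPath.of_append_right
  have huv := ne_of_snd_ne k₁.of_append_left k₂.of_append_left hs
  have hab := notMem_support_of_append huv h₁.isPath
  have hr : q₁.append b ≠ q₃.append b := by
    intro h
    have h' := congrArg Walk.support h
    rw [Walk.support_append, Walk.support_append] at h'
    exact h₁₃ (Walk.ext_support (List.append_cancel_right h'))
  obtain ⟨u', v', a', r₁, r₃, b', e₁, e₃, hs', hp'⟩ := exists_common_prefix_suffix k₁ k₃ hr
  have hu'v' := ne_of_snd_ne (e₁ ▸ k₁).of_append_right.of_append_left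
    (e₃ ▸ k₃).of_append_right.of_append_left hs'
  have hu : u ≠ u' := by
    rintro rfl
    have hnil : a' = Walk.nil := (Walk.isPath_iff_nil.1 (e₁ ▸ k₁).of_append_left).eq_nil
    rw [hnil, Walk.nil_append] at e₁ e₃
    apply hs'
    rw [← snd_append_of_ne r₁ b' hu'v', ← e₁, ← snd_append_of_ne r₃ b' hu'v', ← e₃,
      snd_append_of_ne _ _ huv, snd_append_of_ne _ _ huv, hs₁₃]
  have hv : u ≠ v' := by
    rintro rfl
    exact hu (eq_of_mem_support_append (e₁ ▸ k₁) a'.start_mem_support (by simp))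
  obtain ⟨hm, hme⟩ := snd_mem_innerVertices k₂.of_append_left
    (h₂.two_le_length hH hℓ hhalf h₁ hs.symm)
  have f₁ : a.append (q₁.append b) = (a.append a').append (r₁.append b') := by
    rw [e₁, Walk.append_assoc]
  have f₃ : a.append (q₃.append b) = (a.append a').append (r₃.append b') := by
    rw [e₃, Walk.append_assoc]
  have hmem := (f₁ ▸ h₁).mem_edges_outerPath hH hℓ hhalf hK hxy hpos (f₃ ▸ h₃) hs' hp'
    (w := u) (z := q₂.snd) ⟨(mem_support_outerPath _ _ _).2 (Or.inl (by simp)), hu, hv⟩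
    (q₂.edges_subset_edgeSet hme)
  have hmem' : s(u, q₂.snd) = s(x, y) ∨ s(u, q₂.snd) ∈ (a.append (q₁.append b)).edges := by
    rw [_root_.mem_edges_outerPath] at hmem
    rw [f₁, Walk.edges_append, Walk.edges_append r₁, List.mem_append, List.mem_append]
    tauto
  rcases hmem' with h | h
  · exact h₂.notMem (h ▸ (by simp [Walk.edges_append, hme]))
  rw [Walk.edges_append, Walk.edges_append, List.mem_append, List.mem_append] at h
  rcases h with h | h | h
  · exact hm.2.1 (eq_of_mem_support_append h₂.isPath (a.snd_mem_support_of_mem_edges h)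
      (by simp [hm.1]))
  · exact Set.disjoint_left.1 (h₁.disjoint hH hℓ hpos h₂ hs hp)
      ⟨q₁.snd_mem_support_of_mem_edges h, hm.2⟩ hm
  · exact hab u a.end_mem_support (b.fst_mem_support_of_mem_edges h)

/-- An edge of positive weight that lies on three nonseparating cycles of weight one forces a
Kuratowski minor. -/
lemma isMinor_of_three_tightPaths {V : Type} {H : SimpleGraph V} {ℓ : Sym2 V → ℝ}
    (hH : CycleBound H ℓ) (hℓ : ∀ g, 0 ≤ ℓ g) (hhalf : ∀ g ∈ H.edgeSet, ℓ g < 1 / 2)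
    {x y : V} (hxy : H.Adj x y) (hpos : 0 < ℓ s(x, y)) {p₁ p₂ p₃ : H.Walk x y}
    (h₁ : TightPath H ℓ p₁) (h₂ : TightPath H ℓ p₂) (h₃ : TightPath H ℓ p₃)
    (h₁₂ : p₁ ≠ p₂) (h₁₃ : p₁ ≠ p₃) (h₂₃ : p₂ ≠ p₃) :
    IsMinor (completeGraph (Fin 5)) H ∨ IsMinor (completeBipartiteGraph (Fin 3) (Fin 3)) H := by
  by_cases hK : IsMinor (completeBipartiteGraph (Fin 3) (Fin 3)) H
  · exact Or.inr hK
  obtain ⟨u, v, a, q₁, q₂, b, rfl, rfl, hs, hp⟩ := exists_common_prefix_suffix h₁.isPath h₂.isPath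
    h₁₂
  obtain ⟨q₃, rfl⟩ := h₁.exists_eq_append_append hH hℓ hhalf hK hxy hpos h₂ hs hp h₃
  have n₁₃ : q₁ ≠ q₃ := fun h => h₁₃ (by rw [h])
  have n₂₃ : q₂ ≠ q₃ := fun h => h₂₃ (by rw [h])
  have hs₁₃ := h₁.snd_ne hH hℓ hhalf hK hxy hpos h₂ h₃ hs hp n₁₃
  have hs₂₃ := h₂.snd_ne hH hℓ hhalf hK hxy hpos h₁ h₃ hs.symm hp.symm n₂₃
  have rev : ∀ {q : H.Walk u v}, TightPath H ℓ (a.append (q.append b)) →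
      TightPath H ℓ (b.reverse.append (q.reverse.append a.reverse)) := fun h => by
    simpa [Walk.reverse_append, Walk.append_assoc] using h.reverse
  have hpos' : 0 < ℓ s(y, x) := by rwa [Sym2.eq_swap]
  have hp₁₃ := (rev h₁).snd_ne hH hℓ hhalf hK hxy.symm hpos' (rev h₂) (rev h₃) hp
    (by simpa using hs) (fun h => n₁₃ (Walk.reverse_injective h))
  have hp₂₃ := (rev h₂).snd_ne hH hℓ hhalf hK hxy.symm hpos' (rev h₁) (rev h₃) hp.symm
    (by simpa using hs.symm) (fun h => n₂₃ (Walk.reverse_injective h))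
  have k₁ := h₁.isPath.of_append_right.of_append_left
  have k₂ := h₂.isPath.of_append_right.of_append_left
  have k₃ := h₃.isPath.of_append_right.of_append_left
  have huv := ne_of_snd_ne k₁ k₂ hs
  refine isMinor_of_three_nonSep huv (outerPath_isPath hxy huv h₁.isPath) k₁ k₂ k₃
    (h₁.two_le_length hH hℓ hhalf h₂ hs) (h₂.two_le_length hH hℓ hhalf h₁ hs.symm)
    (h₃.two_le_length hH hℓ hhalf h₁ hs₁₃.symm)
    (disjoint_innerVertices_outerPath hxy h₁.isPath) (disjoint_innerVertices_outerPath hxy h₂.isPath)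
    (disjoint_innerVertices_outerPath hxy h₃.isPath) (h₁.disjoint hH hℓ hpos h₂ hs hp)
    (h₁.disjoint hH hℓ hpos h₃ hs₁₃ hp₁₃) (h₂.disjoint hH hℓ hpos h₃ hs₂₃ hp₂₃) ?_ ?_ ?_
  · rw [thetaEdges_outerPath]; exact h₁.nonSep
  · rw [thetaEdges_outerPath]; exact h₂.nonSep
  · rw [thetaEdges_outerPath]; exact h₃.nonSep

/-- The edges of a graph on a finite vertex set. -/
noncomputable def edgeSetFinset {V : Type} [Fintype V] (H : SimpleGraph V) : Finset (Sym2 V) :=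
  H.edgeSet.toFinite.toFinset

lemma mem_edgeSetFinset {V : Type} [Fintype V] {H : SimpleGraph V} {g : Sym2 V} :
    g ∈ edgeSetFinset H ↔ g ∈ H.edgeSet := by
  simp [edgeSetFinset]

/-- The functions that are constant along the edges of `H`. -/
def locallyConstant {V : Type} (H : SimpleGraph V) : Submodule ℝ (V → ℝ) where
  carrier := {f | ∀ x y, H.Adj x y → f x = f y}
  add_mem' := fun hf hg x y h => by simp [hf x y h, hg x y h]
  zero_mem' := fun x y _ => rfl
  smul_mem' := fun c f hf x y h => by simp [hf x y h]

lemma locallyConstant_anti {V : Type} {H H' : SimpleGraph V} (h : H' ≤ H) :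
    locallyConstant H ≤ locallyConstant H' :=
  fun _ hf x y hxy => hf x y (h hxy)

/-- The dimension of the cycle space of `H`. -/
noncomputable def cyclomatic {V : Type} [Fintype V] (H : SimpleGraph V) : ℤ :=
  (edgeSetFinset H).card - Fintype.card V + Module.finrank ℝ (locallyConstant H)

lemma edgeSetFinset_deleteEdges {V : Type} [Fintype V] [DecidableEq (Sym2 V)] (H : SimpleGraph V)
    (e : Sym2 V) : edgeSetFinset (H.deleteEdges {e}) = (edgeSetFinset H).erase e := by
  ext g
  simp only [mem_edgeSetFinset, edgeSet_deleteEdges, Set.mem_sdiff, Set.mem_singleton_iff,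
    Finset.mem_erase]
  tauto

lemma cyclomatic_le_deleteEdges {V : Type} [Fintype V] {H : SimpleGraph V} {e : Sym2 V}
    (he : e ∈ H.edgeSet) : cyclomatic H ≤ cyclomatic (H.deleteEdges {e}) + 1 := by
  classical
  have h1 := Submodule.finrank_mono (locallyConstant_anti (H.deleteEdges_le {e}))
  have h2 := Finset.card_erase_add_one (mem_edgeSetFinset.2 he)
  rw [cyclomatic, cyclomatic, edgeSetFinset_deleteEdges]
  omega

lemma cyclomatic_le_deleteEdges_of_isBridge {V : Type} [Fintype V] {H : SimpleGraph V}
    {e : Sym2 V} (he : e ∈ H.edgeSet) (hb : H.IsBridge e) :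
    cyclomatic H ≤ cyclomatic (H.deleteEdges {e}) := by
  classical
  have hlt : locallyConstant H < locallyConstant (H.deleteEdges {e}) := by
    refine lt_of_le_of_ne (locallyConstant_anti (H.deleteEdges_le {e})) fun heq => ?_
    induction e with
    | h x y =>
      rw [isBridge_iff] at hb
      set f : V → ℝ := fun z => if (H.deleteEdges {s(x, y)}).Reachable x z then 1 else 0 with hf
      have hmem : f ∈ locallyConstant (H.deleteEdges {s(x, y)}) := by
        intro a b hab
        have : (H.deleteEdges {s(x, y)}).Reachable x a ↔ (H.deleteEdges {s(x, y)}).Reachable x b :=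
          ⟨fun h => h.trans hab.reachable, fun h => h.trans hab.symm.reachable⟩
        simp only [hf, this]
      rw [← heq] at hmem
      have := hmem x y he
      simp [hf, hb] at this
  have h1 := Submodule.finrank_lt_finrank_of_lt hlt
  have h2 := Finset.card_erase_add_one (mem_edgeSetFinset.2 he)
  rw [cyclomatic, cyclomatic, edgeSetFinset_deleteEdges]
  omega

lemma cyclomatic_le_zero_of_isAcyclic {V : Type} [Fintype V] {H : SimpleGraph V}
    (hH : H.IsAcyclic) : cyclomatic H ≤ 0 := by
  classical
  generalize hn : (edgeSetFinset H).card = n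
  induction n generalizing H with
  | zero =>
    have h1 := Submodule.finrank_le (locallyConstant H)
    rw [Module.finrank_fintype_fun_eq_card] at h1
    rw [cyclomatic, hn]
    push_cast
    omega
  | succ n ih =>
    obtain ⟨e, he⟩ : (edgeSetFinset H).Nonempty := Finset.card_pos.1 (by omega)
    have he' := mem_edgeSetFinset.1 he
    refine (cyclomatic_le_deleteEdges_of_isBridge he' (isAcyclic_iff_forall_isBridge.1 hH he')).trans ?_
    refine ih (hH.anti (H.deleteEdges_le {e})) ?_
    rw [edgeSetFinset_deleteEdges, Finset.card_erase_of_mem he, hn, Nat.add_sub_cancel]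

/-- The functions that are constant on `W`. -/
def constantOn {V : Type} (W : Set V) : Submodule ℝ (V → ℝ) where
  carrier := {f | ∀ x ∈ W, ∀ y ∈ W, f x = f y}
  add_mem' := fun hf hg x hx y hy => by simp [hf x hx y hy, hg x hx y hy]
  zero_mem' := fun x _ y _ => rfl
  smul_mem' := fun c f hf x hx y hy => by simp [hf x hx y hy]

lemma card_lt_finrank_constantOn {V : Type} [Fintype V] {W : Finset V} (hW : W.Nonempty) :
    Fintype.card V + 1 ≤ Module.finrank ℝ (constantOn (W : Set V)) + W.card := by
  classical
  obtain ⟨w, hw⟩ := hW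
  let φ : ({x // x ∉ W.erase w} → ℝ) →ₗ[ℝ] constantOn (W : Set V) :=
    { toFun := fun f => ⟨fun x => if hx : x ∈ W.erase w then f ⟨w, by simp⟩ else f ⟨x, hx⟩, by
        have key : ∀ x ∈ W, (if hx : x ∈ W.erase w then f ⟨w, by simp⟩ else f ⟨x, hx⟩) =
            f ⟨w, by simp⟩ := by
          intro x hx
          split_ifs with h
          · rfl
          · have : x = w := by simpa [hx] using h
            subst this
            rfl
        intro x hx y hy
        exact (key x hx).trans (key y hy).symm⟩
      map_add' := fun f g => by
        ext x
        by_cases hx : x ∈ W.erase w <;> simp [-Finset.mem_erase, hx]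
      map_smul' := fun c f => by
        ext x
        by_cases hx : x ∈ W.erase w <;> simp [-Finset.mem_erase, hx] }
  have hφ : Function.Injective φ := by
    intro f g h
    ext ⟨x, hx⟩
    have := congrFun (congrArg Subtype.val h) x
    simpa [φ, -Finset.mem_erase, hx] using this
  have h1 := LinearMap.finrank_le_finrank_of_injective hφ
  rw [Module.finrank_fintype_fun_eq_card, Fintype.card_subtype_compl, Fintype.card_coe,
    Finset.card_erase_of_mem hw] at h1
  have h2 := Finset.card_pos.2 ⟨w, hw⟩
  have h3 := W.card_le_univ
  omega

/-- Moving inside a polyhedron until a further constraint becomes tight: `g` are the slacks and `d`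
the directional derivatives. -/
lemma exists_step {ι : Type} [Fintype ι] (g d : ι → ℝ) (hg : ∀ i, 0 ≤ g i)
    (hd : ∀ i, g i = 0 → d i = 0) (hneg : ∃ i, d i < 0) :
    ∃ t : ℝ, 0 ≤ t ∧ (∀ i, 0 ≤ g i + t * d i) ∧ ∃ i, g i ≠ 0 ∧ g i + t * d i = 0 := by
  classical
  obtain ⟨i, hi⟩ := hneg
  obtain ⟨k, hk, hmin⟩ := Finset.exists_min_image (Finset.univ.filter fun i => d i < 0)
    (fun i => g i / -d i) ⟨i, by simp [hi]⟩
  have hk : d k < 0 := by simpa using hk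
  have hnk : 0 < -d k := by linarith
  have h0 : 0 ≤ g k / -d k := div_nonneg (hg k) hnk.le
  refine ⟨g k / -d k, h0, fun j => ?_, k, fun h => hk.ne (hd k h), ?_⟩
  · by_cases hj : d j < 0
    · have h1 := hmin j (by simp [hj])
      have hnj : 0 < -d j := by linarith
      rw [le_div_iff₀ hnj] at h1
      linarith
    · have := mul_nonneg h0 (not_lt.1 hj)
      have := hg j
      linarith
  · rw [div_neg, neg_mul, div_mul_cancel₀ _ hk.ne, add_neg_cancel]

/-- A weight can be moved to one whose tight constraints determine it, without increasing its
total. -/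
lemma exists_vertex {α : Type} [Fintype α] [DecidableEq α] (𝒞 : Finset (Finset α)) (ℓ : α → ℝ)
    (h0 : ∀ e, 0 ≤ ℓ e) (h1 : ∀ C ∈ 𝒞, 1 ≤ ∑ e ∈ C, ℓ e) :
    ∃ ℓ' : α → ℝ, (∀ e, 0 ≤ ℓ' e) ∧ (∀ C ∈ 𝒞, 1 ≤ ∑ e ∈ C, ℓ' e) ∧ ∑ e, ℓ' e ≤ ∑ e, ℓ e ∧
      ∀ δ : α → ℝ, (∀ e, ℓ' e = 0 → δ e = 0) →
        (∀ C ∈ 𝒞, ∑ e ∈ C, ℓ' e = 1 → ∑ e ∈ C, δ e = 0) → δ = 0 := by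
  classical
  set slack : (α → ℝ) → α ⊕ 𝒞 → ℝ := fun ℓ => Sum.elim ℓ fun C => ∑ e ∈ C.1, ℓ e - 1 with hslack
  generalize hn : (Finset.univ.filter fun i => slack ℓ i ≠ 0).card = n
  induction n using Nat.strong_induction_on generalizing ℓ with
  | _ n ih =>
  by_cases hδ : ∀ δ : α → ℝ, (∀ e, ℓ e = 0 → δ e = 0) →
      (∀ C ∈ 𝒞, ∑ e ∈ C, ℓ e = 1 → ∑ e ∈ C, δ e = 0) → δ = 0
  · exact ⟨ℓ, h0, h1, le_rfl, hδ⟩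
  push Not at hδ
  obtain ⟨δ, hδ0, hδ1, hne, hsum⟩ : ∃ δ : α → ℝ, (∀ e, ℓ e = 0 → δ e = 0) ∧
      (∀ C ∈ 𝒞, ∑ e ∈ C, ℓ e = 1 → ∑ e ∈ C, δ e = 0) ∧ δ ≠ 0 ∧ ∑ e, δ e ≤ 0 := by
    obtain ⟨δ, hδ0, hδ1, hne⟩ := hδ
    rcases le_total (∑ e, δ e) 0 with h | h
    · exact ⟨δ, hδ0, hδ1, hne, h⟩
    · refine ⟨-δ, fun e he => by simp [hδ0 e he], fun C hC hC1 => ?_, neg_ne_zero.2 hne, ?_⟩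
      · simp [hδ1 C hC hC1]
      · simpa using h
  obtain ⟨e, he⟩ : ∃ e, δ e < 0 := by
    by_contra! hpos
    have := (Finset.sum_eq_zero_iff_of_nonneg fun e _ => hpos e).1
      (le_antisymm hsum (Finset.sum_nonneg fun e _ => hpos e))
    exact hne (funext fun e => this e (Finset.mem_univ e))
  set d : α ⊕ 𝒞 → ℝ := Sum.elim δ fun C => ∑ e ∈ C.1, δ e with hd
  obtain ⟨t, ht, hnn, i, hi, hti⟩ := exists_step (slack ℓ) d
    (by
      rintro (e | C)
      · exact h0 e
      · simpa [hslack] using h1 C.1 C.2)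
    (by
      rintro (e | C) h
      · exact hδ0 e h
      · exact hδ1 C.1 C.2 (by simpa [hslack, sub_eq_zero] using h))
    ⟨Sum.inl e, he⟩
  have hnew : ∀ i, slack (ℓ + t • δ) i = slack ℓ i + t * d i := by
    rintro (e | C)
    · simp [hslack, hd]
    · simp only [hslack, hd, Sum.elim_inr, Pi.add_apply, Pi.smul_apply, smul_eq_mul,
        Finset.sum_add_distrib, Finset.mul_sum]
      ring
  have hzero : ∀ i, slack ℓ i = 0 → d i = 0 := by
    rintro (e | C) h
    · exact hδ0 e h
    · exact hδ1 C.1 C.2 (by simpa [hslack, sub_eq_zero] using h)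
  have hlt : (Finset.univ.filter fun i => slack (ℓ + t • δ) i ≠ 0).card < n := by
    rw [← hn]
    refine Finset.card_lt_card ⟨fun j hj => ?_, fun h => ?_⟩
    · simp only [Finset.mem_filter, Finset.mem_univ, true_and, hnew] at hj ⊢
      intro h
      rw [h, hzero j h] at hj
      simp at hj
    · have := h (x := i) (by simpa using hi)
      simp only [Finset.mem_filter, Finset.mem_univ, true_and, hnew] at this
      exact this hti
  obtain ⟨ℓ', k0, k1, k2, k3⟩ := ih _ hlt (ℓ + t • δ)
    (fun e => by have := hnn (Sum.inl e); rwa [← hnew] at this)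
    (fun C hC => by
      have := hnn (Sum.inr ⟨C, hC⟩)
      rw [← hnew] at this
      simpa only [hslack, Sum.elim_inr, sub_nonneg] using this) rfl
  refine ⟨ℓ', k0, k1, k2.trans ?_, k3⟩
  simp only [Pi.add_apply, Pi.smul_apply, smul_eq_mul, Finset.sum_add_distrib, ← Finset.mul_sum]
  have := mul_nonneg ht (neg_nonneg.2 hsum)
  linarith

/-- If the tight constraints determine the weight and each entry is less than one half, then some
entry lies in three tight constraints. -/
lemma exists_mem_three {α : Type} [Fintype α] [DecidableEq α] (T : Finset (Finset α)) (ℓ : α → ℝ)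
    (h0 : ∀ e, 0 ≤ ℓ e) (hhalf : ∀ C ∈ T, ∀ e ∈ C, ℓ e < 1 / 2)
    (h1 : ∀ C ∈ T, ∑ e ∈ C, ℓ e = 1)
    (hδ : ∀ δ : α → ℝ, (∀ e, ℓ e = 0 → δ e = 0) → (∀ C ∈ T, ∑ e ∈ C, δ e = 0) → δ = 0)
    (hne : ∃ e, ℓ e ≠ 0) :
    ∃ e, 0 < ℓ e ∧ 2 < (T.filter fun C => e ∈ C).card := by
  classical
  set P : Finset α := Finset.univ.filter fun e => ℓ e ≠ 0 with hP
  let ext : (P → ℝ) →ₗ[ℝ] (α → ℝ) :=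
    { toFun := fun f e => if h : e ∈ P then f ⟨e, h⟩ else 0
      map_add' := fun f g => by ext e; by_cases h : e ∈ P <;> simp [-Finset.mem_filter, h]
      map_smul' := fun c f => by ext e; by_cases h : e ∈ P <;> simp [-Finset.mem_filter, h] }
  let φ : (P → ℝ) →ₗ[ℝ] (T → ℝ) :=
    { toFun := fun f C => ∑ e ∈ C.1, ext f e
      map_add' := fun f g => by ext C; simp [Finset.sum_add_distrib]
      map_smul' := fun c f => by ext C; simp [Finset.mul_sum] }
  have hφ : Function.Injective φ := by
    rw [injective_iff_map_eq_zero]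
    intro f hf
    have h2 : ext f = 0 := by
      refine hδ _ (fun e he => ?_) fun C hC => congrFun hf ⟨C, hC⟩
      have : e ∉ P := by simp [hP, he]
      simp [ext, -Finset.mem_filter, this]
    ext ⟨e, he⟩
    have := congrFun h2 e
    simpa [ext, -Finset.mem_filter, he] using this
  have hcard : P.card ≤ T.card := by
    have := LinearMap.finrank_le_finrank_of_injective hφ
    simpa using this
  have hthree : ∀ C ∈ T, 3 ≤ (P.filter fun e => e ∈ C).card := by
    intro C hC
    by_contra! hlt
    have h2 : ∑ e ∈ P.filter (fun e => e ∈ C), ℓ e = 1 := by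
      rw [← h1 C hC]
      refine Finset.sum_subset_zero_on_sdiff (fun e he => (Finset.mem_filter.1 he).2) ?_ fun _ _ => rfl
      intro e he
      simp only [hP, Finset.mem_sdiff, Finset.mem_filter, Finset.mem_univ, true_and, not_and] at he
      by_contra h
      exact he.2 h he.1
    have hne : (P.filter fun e => e ∈ C).Nonempty := by
      by_contra h
      rw [Finset.not_nonempty_iff_eq_empty.1 h] at h2
      simp at h2
    have h3 := Finset.sum_lt_sum_of_nonempty hne
      (fun e he => hhalf C hC e (Finset.mem_filter.1 he).2)
    rw [h2, Finset.sum_const, nsmul_eq_mul] at h3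
    have h4 : ((P.filter fun e => e ∈ C).card : ℝ) ≤ 2 := by exact_mod_cast Nat.lt_succ_iff.1 hlt
    linarith
  have hdouble : ∑ C ∈ T, (P.filter fun e => e ∈ C).card =
      ∑ e ∈ P, (T.filter fun C => e ∈ C).card := by
    simp only [Finset.card_filter]
    exact Finset.sum_comm
  by_contra! hall
  have h5 : ∑ e ∈ P, (T.filter fun C => e ∈ C).card ≤ P.card * 2 := by
    refine Finset.sum_le_card_nsmul _ _ _ fun e he => hall e ?_
    exact lt_of_le_of_ne (h0 e) (Finset.mem_filter.1 he).2.symm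
  have h6 : T.card * 3 ≤ ∑ C ∈ T, (P.filter fun e => e ∈ C).card :=
    Finset.card_nsmul_le_sum _ _ _ hthree
  obtain ⟨e, he⟩ := hne
  have h7 : 0 < P.card := Finset.card_pos.2 ⟨e, by simp [hP, he]⟩
  omega

/-- `C` is the edge set of a cycle of `H`. -/
def IsCycleSet {V : Type} (H : SimpleGraph V) (C : Finset (Sym2 V)) : Prop :=
  ∃ (v : V) (c : H.Walk v v), c.IsCycle ∧ ∀ g, g ∈ C ↔ g ∈ c.edges

lemma walkLen_eq_sum {V : Type} {H : SimpleGraph V} {ℓ : Sym2 V → ℝ} {u v : V} {p : H.Walk u v}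
    (hp : p.edges.Nodup) {C : Finset (Sym2 V)} (hC : ∀ g, g ∈ C ↔ g ∈ p.edges) :
    walkLen ℓ p = ∑ g ∈ C, ℓ g := by
  classical
  have : C = p.edges.toFinset := by
    ext g
    simp [hC]
  rw [walkLen, this, List.sum_toFinset _ hp]

lemma exists_isCycleSet {V : Type} {H : SimpleGraph V} {v : V} {c : H.Walk v v} (hc : c.IsCycle) :
    ∃ C, IsCycleSet H C ∧ ∀ ℓ : Sym2 V → ℝ, walkLen ℓ c = ∑ g ∈ C, ℓ g := by
  classical
  have h : ∀ g, g ∈ c.edges.toFinset ↔ g ∈ c.edges := fun g => List.mem_toFinset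
  exact ⟨c.edges.toFinset, ⟨v, c, hc, h⟩, fun ℓ => walkLen_eq_sum hc.edges_nodup h⟩

lemma cycleBound_iff {V : Type} {H : SimpleGraph V} {ℓ : Sym2 V → ℝ} :
    CycleBound H ℓ ↔ ∀ C, IsCycleSet H C → 1 ≤ ∑ g ∈ C, ℓ g := by
  constructor
  · rintro h C ⟨v, c, hc, hC⟩
    rw [← walkLen_eq_sum hc.edges_nodup hC]
    exact h c hc
  · intro h v c hc
    obtain ⟨C, hC, hsum⟩ := exists_isCycleSet hc
    rw [hsum]
    exact h C hC

lemma IsCycleSet.mem_edgeSet {V : Type} {H : SimpleGraph V} {C : Finset (Sym2 V)}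
    (hC : IsCycleSet H C) {g : Sym2 V} (hg : g ∈ C) : g ∈ H.edgeSet := by
  obtain ⟨v, c, hc, h⟩ := hC
  exact c.edges_subset_edgeSet ((h g).1 hg)

lemma IsCycleSet.transfer {V : Type} {H H' : SimpleGraph V} {C : Finset (Sym2 V)}
    (hC : IsCycleSet H C) (hH' : ∀ g ∈ C, g ∈ H'.edgeSet) : IsCycleSet H' C := by
  obtain ⟨v, c, hc, h⟩ := hC
  exact ⟨v, c.transfer H' fun g hg => hH' g ((h g).2 hg), hc.transfer _, by simpa using h⟩

lemma IsCycleSet.not_isAcyclic {V : Type} {H : SimpleGraph V} {C : Finset (Sym2 V)}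
    (hC : IsCycleSet H C) : ¬ H.IsAcyclic := by
  obtain ⟨v, c, hc, -⟩ := hC
  exact fun h => h c hc

lemma exists_isCycleSet_of_not_isAcyclic {V : Type} {H : SimpleGraph V} (h : ¬ H.IsAcyclic) :
    ∃ C, IsCycleSet H C := by
  simp only [IsAcyclic, not_forall, not_not] at h
  obtain ⟨v, c, hc⟩ := h
  obtain ⟨C, hC, -⟩ := exists_isCycleSet hc
  exact ⟨C, hC⟩

lemma IsCycleSet.exists_vertices {V : Type} {H : SimpleGraph V} {C : Finset (Sym2 V)}
    (hC : IsCycleSet H C) :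
    ∃ W : Finset V, W.Nonempty ∧ W.card ≤ C.card ∧ ∀ v, v ∈ W ↔ ∃ g ∈ C, v ∈ g := by
  classical
  obtain ⟨v, c, hc, h⟩ := hC
  refine ⟨c.support.toFinset, ⟨v, by simp⟩, ?_, fun w => ?_⟩
  · have h1 : c.support.toFinset = c.support.tail.toFinset := by
      ext w
      rw [List.mem_toFinset, List.mem_toFinset, Walk.mem_support_iff]
      refine or_iff_right_of_imp ?_
      rintro rfl
      exact Walk.end_mem_tail_support hc.not_nil
    have h2 : C = c.edges.toFinset := by
      ext g
      simp [h]
    rw [h1, h2, List.toFinset_card_of_nodup hc.edges_nodup, Walk.length_edges]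
    refine (List.toFinset_card_le _).trans ?_
    simp
  · rw [List.mem_toFinset, Walk.mem_support_iff_exists_mem_edges_of_not_nil hc.not_nil]
    simp [h]

lemma IsCycleSet.exists_path {V : Type} {H : SimpleGraph V} {C : Finset (Sym2 V)}
    (hC : IsCycleSet H C) {x y : V} (hxy : s(x, y) ∈ C) :
    ∃ p : H.Walk x y, p.IsPath ∧ s(x, y) ∉ p.edges ∧
      ∀ g, g ∈ C ↔ g = s(x, y) ∨ g ∈ p.edges := by
  classical
  obtain ⟨v, c', hc', h'⟩ := hC
  have hx : x ∈ c'.support := c'.fst_mem_support_of_mem_edges ((h' _).1 hxy)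
  set c := c'.rotate x hx with hcdef
  have hc : c.IsCycle := hc'.rotate hx
  have h : ∀ g, g ∈ C ↔ g ∈ c.edges := fun g => by
    rw [h', hcdef, (Walk.rotate_edges c' x hx).mem_iff]
  clear_value c
  clear h' hc' hcdef
  cases c with
  | nil => simp at hc
  | cons hxa q =>
    rename_i a
    rw [Walk.cons_isCycle_iff] at hc
    obtain ⟨hq, hnot⟩ := hc
    have hxy' := (h _).1 hxy
    rw [Walk.edges_cons, List.mem_cons] at hxy'
    by_cases hay : a = y
    · subst hay
      refine ⟨q.reverse, hq.reverse, by simpa using hnot, fun g => by simp [h]⟩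
    · have hyq : s(x, y) ∈ q.edges := by
        refine hxy'.resolve_left fun he => hay ?_
        simpa using (Sym2.congr_right.1 he).symm
      have hqr : s(x, y) ∈ q.reverse.edges := by simpa using hyq
      have hqp := hq.reverse
      generalize hr : q.reverse = r at hqr hqp
      have hq' : q = r.reverse := by rw [← hr, Walk.reverse_reverse]
      subst hq'
      cases r with
      | nil => simp at hqr
      | cons hxb r =>
        rename_i b
        have hb : y = b := by
          have := hqp.eq_snd_of_mem_edges hqr
          simpa using this
        subst hb
        rw [Walk.cons_isPath_iff] at hqp
        refine ⟨Walk.cons hxa r.reverse, ?_, ?_, fun g => ?_⟩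
        · rw [Walk.cons_isPath_iff]
          exact ⟨hqp.1.reverse, by simpa using hqp.2⟩
        · rw [Walk.edges_cons, List.mem_cons, not_or]
          refine ⟨fun he => hay (by simpa using (Sym2.congr_right.1 he).symm), fun he => hqp.2 ?_⟩
          exact r.fst_mem_support_of_mem_edges (by simpa using he)
        · have e : s(y, x) = s(x, y) := Sym2.eq_swap
          simp only [h, Walk.edges_cons, Walk.reverse_cons, Walk.edges_append, List.mem_cons,
            List.mem_append, Walk.edges_reverse, List.mem_reverse, Walk.edges_nil, List.not_mem_nil,
            or_false, e]
          tauto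

/-- A cycle that separates the remaining edges splits the graph in two smaller graphs sharing that
cycle. -/
lemma IsCycleSet.exists_split {V : Type} [Fintype V] {H : SimpleGraph V} {C : Finset (Sym2 V)}
    (hC : IsCycleSet H C) (hns : ¬ NonSep H (C : Set (Sym2 V))) :
    ∃ H₁ H₂ : SimpleGraph V, H₁ ≤ H ∧ H₂ ≤ H ∧ IsCycleSet H₁ C ∧ IsCycleSet H₂ C ∧
      (edgeSetFinset H₁).card < (edgeSetFinset H).card ∧
      (edgeSetFinset H₂).card < (edgeSetFinset H).card ∧
      cyclomatic H + 1 ≤ cyclomatic H₁ + cyclomatic H₂ ∧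
      ∀ ℓ : Sym2 V → ℝ, ∑ g ∈ edgeSetFinset H₁, ℓ g + ∑ g ∈ edgeSetFinset H₂, ℓ g =
        ∑ g ∈ edgeSetFinset H, ℓ g + ∑ g ∈ C, ℓ g := by
  classical
  simp only [NonSep, not_forall, not_exists, not_and] at hns
  obtain ⟨E, hE, ⟨e, he⟩, ⟨e', he'⟩, hsep⟩ := hns
  obtain ⟨W, hW, hWC, hmem⟩ := hC.exists_vertices
  set H₁ := H.deleteEdges ((H.edgeSet \ C) \ E) with hH₁
  set H₂ := H.deleteEdges E with hH₂
  have m₁ : ∀ g, g ∈ H₁.edgeSet ↔ g ∈ C ∨ g ∈ E := fun g => by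
    have h1 : g ∈ C → g ∈ H.edgeSet := hC.mem_edgeSet
    have h2 : g ∈ E → g ∈ H.edgeSet := fun h => (hE h).1
    simp only [hH₁, edgeSet_deleteEdges, Set.mem_sdiff, Finset.mem_coe]
    tauto
  have m₂ : ∀ g, g ∈ H₂.edgeSet ↔ g ∈ H.edgeSet ∧ g ∉ E := fun g => by
    simp only [hH₂, edgeSet_deleteEdges, Set.mem_sdiff]
  have hCE : ∀ g ∈ C, g ∉ E := fun g hg h => (hE h).2 hg
  have hunion : edgeSetFinset H₁ ∪ edgeSetFinset H₂ = edgeSetFinset H := by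
    ext g
    have h1 : g ∈ C → g ∈ H.edgeSet := hC.mem_edgeSet
    have h2 : g ∈ E → g ∈ H.edgeSet := fun h => (hE h).1
    simp only [Finset.mem_union, mem_edgeSetFinset, m₁, m₂]
    tauto
  have hinter : edgeSetFinset H₁ ∩ edgeSetFinset H₂ = C := by
    ext g
    have h1 : g ∈ C → g ∈ H.edgeSet := hC.mem_edgeSet
    have h2 := hCE g
    simp only [Finset.mem_inter, mem_edgeSetFinset, m₁, m₂]
    tauto
  have hinf : locallyConstant H₁ ⊓ locallyConstant H₂ ≥ locallyConstant H :=
    le_inf (locallyConstant_anti (H.deleteEdges_le _)) (locallyConstant_anti (H.deleteEdges_le _))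
  have hsup : constantOn (W : Set V) ≤ locallyConstant H₁ ⊔ locallyConstant H₂ := by
    intro f hf
    obtain ⟨w, hw⟩ := hW
    set f₁ : V → ℝ := fun v => if v ∈ W ∨ ∃ g ∈ E, v ∈ g then f w else f v with hf₁
    have hfW : ∀ v ∈ W, f v = f w := fun v hv => hf v hv w hw
    refine Submodule.mem_sup.2 ⟨f₁, fun x y hxy => ?_, f - f₁, fun x y hxy => ?_,
      add_sub_cancel f₁ f⟩
    · have key : ∀ v ∈ s(x, y), f₁ v = f w := fun v hv => by
        refine if_pos (((m₁ s(x, y)).1 hxy).imp (fun h => (hmem v).2 ⟨_, h, hv⟩) fun h => ⟨_, h, hv⟩)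
      rw [key x (Sym2.mem_mk_left x y), key y (Sym2.mem_mk_right x y)]
    · have key : ∀ v ∈ s(x, y), (f - f₁) v = 0 := fun v hv => by
        rw [Pi.sub_apply, sub_eq_zero]
        by_cases hvW : v ∈ W
        · rw [hfW v hvW, hf₁]
          exact (if_pos (Or.inl hvW)).symm
        · refine (if_neg ?_).symm
          rintro (h | ⟨g, hg, hvg⟩)
          · exact hvW h
          · have hxy' := (m₂ s(x, y)).1 hxy
            refine hsep v (fun g hg hvg => hvW ((hmem v).2 ⟨g, hg, hvg⟩)) ⟨g, hg, hvg⟩ s(x, y)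
              ⟨⟨hxy'.1, fun h => hvW ((hmem v).2 ⟨_, h, hv⟩)⟩, hxy'.2⟩ hv
      rw [key x (Sym2.mem_mk_left x y), key y (Sym2.mem_mk_right x y)]
  have hfin := Submodule.finrank_mono hsup
  have hfin' := Submodule.finrank_mono hinf
  have hdim := Submodule.finrank_sup_add_finrank_inf_eq (locallyConstant H₁) (locallyConstant H₂)
  have hcW := card_lt_finrank_constantOn hW
  have hcard := Finset.card_union_add_card_inter (edgeSetFinset H₁) (edgeSetFinset H₂)
  rw [hunion, hinter] at hcard
  refine ⟨H₁, H₂, H.deleteEdges_le _, H.deleteEdges_le _,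
    hC.transfer fun g hg => (m₁ g).2 (Or.inl hg),
    hC.transfer fun g hg => (m₂ g).2 ⟨hC.mem_edgeSet hg, hCE g hg⟩, ?_, ?_, ?_, fun ℓ => ?_⟩
  · refine Finset.card_lt_card ⟨hunion ▸ Finset.subset_union_left, fun h => ?_⟩
    have := (m₁ e').1 (mem_edgeSetFinset.1 (h (mem_edgeSetFinset.2 he'.1.1)))
    exact this.elim he'.1.2 he'.2
  · refine Finset.card_lt_card ⟨hunion ▸ Finset.subset_union_right, fun h => ?_⟩
    have := (m₂ e).1 (mem_edgeSetFinset.1 (h (mem_edgeSetFinset.2 (hE he).1)))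
    exact this.2 he
  · rw [cyclomatic, cyclomatic, cyclomatic]
    omega
  · rw [← Finset.sum_union_inter, hunion, hinter]

/-- In a graph without Kuratowski minors, a weight that is at least one on each cycle has total at
least half of the cyclomatic number plus one. -/
theorem cyclomatic_add_one_le {V : Type} [Fintype V] {H : SimpleGraph V} {ℓ : Sym2 V → ℝ}
    (hp : IsPlanar H) (h0 : ∀ g, 0 ≤ ℓ g) (hb : CycleBound H ℓ) (hH : ¬ H.IsAcyclic) :
    (cyclomatic H : ℝ) + 1 ≤ 2 * ∑ g ∈ edgeSetFinset H, ℓ g := by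
  classical
  generalize hn : (edgeSetFinset H).card = n
  induction n using Nat.strong_induction_on generalizing H ℓ with
  | _ n ih =>
  have hsum_univ : ∑ g, (if g ∈ H.edgeSet then ℓ g else 0) = ∑ g ∈ edgeSetFinset H, ℓ g := by
    rw [← Finset.sum_filter]
    refine Finset.sum_congr ?_ fun _ _ => rfl
    ext g
    simp [mem_edgeSetFinset]
  obtain ⟨ℓ', k0, k1, k2, k3⟩ := exists_vertex (Finset.univ.filter fun C => IsCycleSet H C)
    (fun g => if g ∈ H.edgeSet then ℓ g else 0) (fun g => by split_ifs <;> simp [h0])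
    (fun C hC => by
      have hC : IsCycleSet H C := by simpa using hC
      refine (cycleBound_iff.1 hb C hC).trans_eq (Finset.sum_congr rfl fun g hg => ?_)
      rw [if_pos (hC.mem_edgeSet hg)])
  rw [hsum_univ] at k2
  have k1 : ∀ C, IsCycleSet H C → 1 ≤ ∑ g ∈ C, ℓ' g := fun C hC => k1 C (by simpa using hC)
  have hsub : ∑ g ∈ edgeSetFinset H, ℓ' g ≤ ∑ g ∈ edgeSetFinset H, ℓ g :=
    (Finset.sum_le_univ_sum_of_nonneg k0).trans k2
  refine le_trans ?_ (mul_le_mul_of_nonneg_left hsub zero_le_two)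
  clear hsub k2 hsum_univ hb h0
  have hmono : ∀ H' : SimpleGraph V, H' ≤ H → (edgeSetFinset H').card < n → ¬ H'.IsAcyclic →
      (cyclomatic H' : ℝ) + 1 ≤ 2 * ∑ g ∈ edgeSetFinset H', ℓ' g := fun H' hle hlt hac => by
    refine ih _ hlt ⟨fun h => hp.1 (h.mono hle), fun h => hp.2 (h.mono hle)⟩ k0 ?_ hac rfl
    refine cycleBound_iff.2 fun C hC => k1 C (hC.transfer fun g hg => ?_)
    exact edgeSet_mono hle (hC.mem_edgeSet hg)
  obtain ⟨C₀, hC₀⟩ := exists_isCycleSet_of_not_isAcyclic hH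
  by_cases hhalf : ∀ g ∈ H.edgeSet, ℓ' g < 1 / 2
  swap
  · push Not at hhalf
    obtain ⟨e, he, hle⟩ := hhalf
    have hcyc := cyclomatic_le_deleteEdges he
    by_cases hac : (H.deleteEdges {e}).IsAcyclic
    · have h1 := cyclomatic_le_zero_of_isAcyclic hac
      have h2 : (cyclomatic H : ℝ) ≤ 1 := by exact_mod_cast (by omega : cyclomatic H ≤ 1)
      have h3 : ∑ g ∈ C₀, ℓ' g ≤ ∑ g ∈ edgeSetFinset H, ℓ' g :=
        Finset.sum_le_sum_of_subset_of_nonneg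
          (fun g hg => mem_edgeSetFinset.2 (hC₀.mem_edgeSet hg)) fun g _ _ => k0 g
      have h4 := k1 C₀ hC₀
      linarith
    · have hdel := edgeSetFinset_deleteEdges H e
      have he' := mem_edgeSetFinset.2 he
      have h1 := hmono _ (H.deleteEdges_le {e})
        (by rw [hdel, ← hn]; exact Finset.card_erase_lt_of_mem he') hac
      have h2 := Finset.add_sum_erase _ ℓ' he'
      have h3 : (cyclomatic H : ℝ) ≤ cyclomatic (H.deleteEdges {e}) + 1 := by exact_mod_cast hcyc
      rw [hdel] at h1
      linarith
  by_cases hns : ∃ C, IsCycleSet H C ∧ ∑ g ∈ C, ℓ' g = 1 ∧ ¬ NonSep H (C : Set (Sym2 V))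
  · obtain ⟨C, hC, hC1, hns⟩ := hns
    obtain ⟨H₁, H₂, hle₁, hle₂, hC₁, hC₂, hlt₁, hlt₂, hcyc, hsum⟩ := hC.exists_split hns
    have h1 := hmono H₁ hle₁ (hn ▸ hlt₁) hC₁.not_isAcyclic
    have h2 := hmono H₂ hle₂ (hn ▸ hlt₂) hC₂.not_isAcyclic
    have h3 := hsum ℓ'
    have h4 : (cyclomatic H : ℝ) + 1 ≤ cyclomatic H₁ + cyclomatic H₂ := by exact_mod_cast hcyc
    linarith
  exfalso
  push Not at hns
  set T := Finset.univ.filter fun C => IsCycleSet H C ∧ ∑ g ∈ C, ℓ' g = 1 with hT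
  have hmemT : ∀ C, C ∈ T ↔ IsCycleSet H C ∧ ∑ g ∈ C, ℓ' g = 1 := fun C => by simp [hT]
  obtain ⟨e, hpos, hthree⟩ := exists_mem_three T ℓ' k0
    (fun C hC g hg => hhalf g (((hmemT C).1 hC).1.mem_edgeSet hg)) (fun C hC => ((hmemT C).1 hC).2)
    (fun δ h0 h1 => k3 δ h0 fun C hC hC1 => h1 C ((hmemT C).2 ⟨by simpa using hC, hC1⟩))
    (by
      by_contra! h
      have := k1 C₀ hC₀
      rw [Finset.sum_eq_zero fun g _ => h g] at this
      linarith)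
  obtain ⟨C₁, h₁, C₂, h₂, C₃, h₃, h₁₂, h₁₃, h₂₃⟩ := Finset.two_lt_card.1 hthree
  induction e with
  | h x y =>
  have key : ∀ C ∈ T.filter (fun C => s(x, y) ∈ C), ∃ p : H.Walk x y, TightPath H ℓ' p ∧
      ∀ g, g ∈ C ↔ g = s(x, y) ∨ g ∈ p.edges := fun C hC => by
    rw [Finset.mem_filter, hmemT] at hC
    obtain ⟨⟨hC, hC1⟩, hxy⟩ := hC
    obtain ⟨p, hp, hnot, hpC⟩ := hC.exists_path hxy
    refine ⟨p, ⟨hp, hnot, ?_, ?_⟩, hpC⟩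
    · have h1 : walkLen ℓ' p = ∑ g ∈ C.erase s(x, y), ℓ' g :=
        walkLen_eq_sum hp.isTrail.edges_nodup fun g => by
          rw [Finset.mem_erase, hpC]
          refine ⟨fun h => h.2.resolve_left h.1, fun h => ⟨?_, Or.inr h⟩⟩
          rintro rfl
          exact hnot h
      rw [h1, ← hC1, ← Finset.add_sum_erase _ ℓ' hxy, add_sub_cancel_left]
    · have h1 : {g | g = s(x, y) ∨ g ∈ p.edges} = (C : Set (Sym2 V)) := by
        ext g
        simp [hpC]
      rw [h1]
      exact hns C hC hC1
  have hne : ∀ {C C' : Finset (Sym2 V)} {p p' : H.Walk x y},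
      (∀ g, g ∈ C ↔ g = s(x, y) ∨ g ∈ p.edges) → (∀ g, g ∈ C' ↔ g = s(x, y) ∨ g ∈ p'.edges) →
      C ≠ C' → p ≠ p' := fun h h' hne hpp => by
    subst hpp
    exact hne (Finset.ext fun g => (h g).trans (h' g).symm)
  obtain ⟨p₁, t₁, e₁⟩ := key C₁ h₁
  obtain ⟨p₂, t₂, e₂⟩ := key C₂ h₂
  obtain ⟨p₃, t₃, e₃⟩ := key C₃ h₃
  have hxy : H.Adj x y := by
    rw [Finset.mem_filter, hmemT] at h₁
    exact h₁.1.1.mem_edgeSet h₁.2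
  exact (isMinor_of_three_tightPaths (cycleBound_iff.2 k1) k0 hhalf hxy hpos t₁ t₂ t₃
    (hne e₁ e₂ h₁₂) (hne e₁ e₃ h₁₃) (hne e₂ e₃ h₂₃)).elim hp.1 hp.2

/-- A planar graph without cycles of length less than six spans at most `3 / 2 * |W| - 3` edges on
a set `W` of at least four vertices. -/
lemma IsPlanar.two_mul_card_edges_le {V : Type} [Fintype V] {H : SimpleGraph V} (hp : IsPlanar H)
    (hg : (6 : ℕ∞) ≤ H.egirth) {W : Finset V} (hW : 4 ≤ W.card) {F : Finset (Sym2 V)}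
    (hF : ∀ g ∈ F, g ∈ H.edgeSet ∧ ∀ v ∈ g, v ∈ W) : 2 * F.card + 6 ≤ 3 * W.card := by
  classical
  set J := fromEdgeSet (F : Set (Sym2 V)) with hJ
  have hJF : edgeSetFinset J = F := by
    ext g
    rw [mem_edgeSetFinset, hJ, edgeSet_fromEdgeSet]
    exact ⟨fun h => h.1, fun h => ⟨h, H.not_isDiag_of_mem_edgeSet (hF g h).1⟩⟩
  have hle : J ≤ H := by
    rw [← edgeSet_subset_edgeSet]
    intro g hg
    rw [← mem_edgeSetFinset, hJF] at hg
    exact (hF g hg).1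
  have hcon : constantOn (W : Set V) ≤ locallyConstant J := by
    intro f hf x y hxy
    have := (hF s(x, y) (hJF ▸ mem_edgeSetFinset.2 hxy)).2
    exact hf x (this x (Sym2.mem_mk_left x y)) y (this y (Sym2.mem_mk_right x y))
  have h1 := Submodule.finrank_mono hcon
  have h2 := card_lt_finrank_constantOn (Finset.card_pos.1 (by omega : 0 < W.card))
  have h3 : (F.card : ℤ) + 1 ≤ cyclomatic J + W.card := by
    rw [cyclomatic, hJF]
    omega
  by_cases hac : J.IsAcyclic
  · have h4 := cyclomatic_le_zero_of_isAcyclic hac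
    omega
  · have h4 := cyclomatic_add_one_le (H := J) (ℓ := fun _ => 1 / 6)
      ⟨fun h => hp.1 (h.mono hle), fun h => hp.2 (h.mono hle)⟩ (fun _ => by norm_num)
      (fun v c hc => by
        have h5 := le_egirth.1 hg _ (c.mapLe hle) (hc.mapLe hle)
        rw [Walk.length_map] at h5
        have h6 : (6 : ℝ) ≤ c.length := by exact_mod_cast h5
        simp only [walkLen, List.map_const', List.sum_replicate, Walk.length_edges, nsmul_eq_mul]
        linarith) hac
    rw [hJF, Finset.sum_const, nsmul_eq_mul] at h4
    have h5 : (F.card : ℝ) + 1 ≤ cyclomatic J + W.card := by exact_mod_cast h3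
    have h6 : (2 * F.card + 6 : ℝ) ≤ 3 * W.card := by linarith
    exact_mod_cast h6

/-- In a graph of thickness at most `t` and girth at least six, the degrees within a set `W` of at
least four vertices add up to at most `t * (3 * |W| - 6)`. -/
lemma ThicknessLE.sum_card_inter_le {V : Type} [Fintype V] [DecidableEq V] {G : SimpleGraph V}
    [DecidableRel G.Adj] {t : ℕ} (ht : ThicknessLE G t) (hg : (6 : ℕ∞) ≤ G.egirth) {W : Finset V}
    (hW : 4 ≤ W.card) :
    ∑ u ∈ W, (G.neighborFinset u ∩ W).card + t * 6 ≤ t * (3 * W.card) := by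
  classical
  obtain ⟨c, hc⟩ := ht
  set F := G.edgeFinset.filter fun g => ∀ v ∈ g, v ∈ W with hF
  have hdeg : ∑ u ∈ W, (G.neighborFinset u ∩ W).card = 2 * F.card := by
    obtain ⟨J, hJ⟩ : ∃ J, J = fromEdgeSet (F : Set (Sym2 V)) := ⟨_, rfl⟩
    have hadj : ∀ u v, J.Adj u v ↔ G.Adj u v ∧ u ∈ W ∧ v ∈ W := fun u v => by
      have := @Adj.ne V G u v
      simp only [hJ, fromEdgeSet_adj, hF, Finset.coe_filter, mem_edgeFinset]
      simp
      tauto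
    have hJF : ∀ [Fintype J.edgeSet], J.edgeFinset = F := by
      intro _
      ext g
      induction g with
      | h u v => simp [hadj, hF]
    have hJdeg := J.sum_degrees_eq_twice_card_edges
    rw [hJF] at hJdeg
    rw [← hJdeg, ← Finset.sum_subset (Finset.subset_univ W)]
    · refine Finset.sum_congr rfl fun u hu => ?_
      rw [← card_neighborFinset_eq_degree]
      congr 1
      ext v
      simp [hadj, hu]
    · intro u _ hu
      rw [← card_neighborFinset_eq_degree, Finset.card_eq_zero]
      ext v
      simp [hadj, hu]
  have hpart : ∀ i : Fin t, 2 * (F.filter fun g => c g = i).card + 6 ≤ 3 * W.card := fun i => by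
    have hle : fromEdgeSet {e | e ∈ G.edgeSet ∧ c e = i} ≤ G := by
      intro u v huv
      exact ((fromEdgeSet_adj _).1 huv).1.1
    refine (hc i).two_mul_card_edges_le (hg.trans (egirth_anti hle)) hW fun g hg => ?_
    simp only [hF, Finset.mem_filter, mem_edgeFinset] at hg
    refine ⟨?_, hg.1.2⟩
    rw [edgeSet_fromEdgeSet]
    exact ⟨⟨hg.1.1, hg.2⟩, G.not_isDiag_of_mem_edgeSet hg.1.1⟩
  have hsum := Finset.sum_le_card_nsmul Finset.univ _ _ fun i _ => hpart i
  rw [Finset.sum_add_distrib, ← Finset.mul_sum,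
    ← Finset.card_eq_sum_card_fiberwise fun g _ => Finset.mem_coe.2 (Finset.mem_univ (c g))] at hsum
  simpa [hdeg] using hsum

/-- A set of odd size has a color class of odd size. -/
lemma exists_odd_card_filter {α : Type} {k : ℕ} {S : Finset α} (hS : Odd S.card) (φ : α → Fin k) :
    ∃ c, Odd (S.filter fun u => φ u = c).card := by
  by_contra! h
  rw [Finset.card_eq_sum_card_fiberwise fun u _ => Finset.mem_coe.2 (Finset.mem_univ (φ u))] at hS
  exact Nat.not_even_iff_odd.2 hS
    (Finset.even_sum _ fun c _ => Nat.not_odd_iff_even.1 (h c))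

/-- The vertices of positive even degree all of whose neighbors lie in `B`. -/
def evenInside {V : Type} [Fintype V] [DecidableEq V] (G : SimpleGraph V) [DecidableRel G.Adj]
    (B : Finset V) : Finset V :=
  Finset.univ.filter fun w => Even (G.degree w) ∧ 0 < G.degree w ∧ G.neighborFinset w ⊆ B

lemma mem_evenInside {V : Type} [Fintype V] [DecidableEq V] {G : SimpleGraph V}
    [DecidableRel G.Adj] {B : Finset V} {w : V} : w ∈ evenInside G B ↔
      Even (G.degree w) ∧ 0 < G.degree w ∧ G.neighborFinset w ⊆ B := by
  simp [evenInside]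

/-- Coloring greedily: it suffices that each set `B` has a vertex with few constraints. -/
lemma exists_coloring {V : Type} [Fintype V] [DecidableEq V] {G : SimpleGraph V}
    [DecidableRel G.Adj] {k : ℕ} (hk : 0 < k)
    (h : ∀ B : Finset V, B.Nonempty →
      ∃ v ∈ B, (G.neighborFinset v ∩ B).card + (G.neighborFinset v ∩ evenInside G B).card < k)
    (B : Finset V) :
    ∃ φ : V → Fin k, (∀ u ∈ B, ∀ v ∈ B, G.Adj u v → φ u ≠ φ v) ∧
      ∀ w ∈ evenInside G B, ∃ c, Odd ((G.neighborFinset w).filter fun u => φ u = c).card := by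
  induction B using Finset.strongInduction with
  | _ B ih =>
  rcases B.eq_empty_or_nonempty with rfl | hB
  · refine ⟨fun _ => ⟨0, hk⟩, by simp, fun w hw => ?_⟩
    obtain ⟨-, hpos, hsub⟩ := mem_evenInside.1 hw
    rw [Finset.subset_empty, ← Finset.card_eq_zero, card_neighborFinset_eq_degree] at hsub
    omega
  obtain ⟨v, hv, hcost⟩ := h B hB
  obtain ⟨φ, hφ, hodd⟩ := ih (B.erase v) (Finset.erase_ssubset hv)
  have hrest : ∀ w, ∃ c, w ∈ G.neighborFinset v ∩ evenInside G B →
      Odd (((G.neighborFinset w).erase v).filter fun u => φ u = c).card := fun w => by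
    by_cases hw : w ∈ G.neighborFinset v ∩ evenInside G B
    · rw [Finset.mem_inter, mem_neighborFinset, mem_evenInside] at hw
      obtain ⟨c, hc⟩ := exists_odd_card_filter (S := (G.neighborFinset w).erase v) (by
        rw [Finset.card_erase_of_mem (by simpa using hw.1.symm), card_neighborFinset_eq_degree]
        exact Nat.Even.sub_odd hw.2.2.1 hw.2.1 odd_one) φ
      exact ⟨c, fun _ => hc⟩
    · exact ⟨⟨0, hk⟩, fun h => absurd h hw⟩
  choose d hd using hrest
  obtain ⟨c, hc⟩ : ∃ c, c ∉ (G.neighborFinset v ∩ B).image φ ∪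
      (G.neighborFinset v ∩ evenInside G B).image d := by
    by_contra! hall
    have h1 : (Finset.univ : Finset (Fin k)).card ≤ _ :=
      Finset.card_le_card fun c _ => hall c
    have h2 := h1.trans (Finset.card_union_le _ _)
    have h3 := (G.neighborFinset v ∩ B).card_image_le (f := φ)
    have h4 := (G.neighborFinset v ∩ evenInside G B).card_image_le (f := d)
    rw [Finset.card_univ, Fintype.card_fin] at h2
    omega
  rw [Finset.mem_union, not_or] at hc
  have hcφ : ∀ u ∈ B, G.Adj v u → φ u ≠ c := fun u hu hvu he =>
    hc.1 (Finset.mem_image.2 ⟨u, by simp [hu, hvu], he⟩)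
  refine ⟨Function.update φ v c, fun u hu u' hu' huu' => ?_, fun w hw => ?_⟩
  · by_cases h1 : u = v
    · subst h1
      rw [Function.update_self, Function.update_of_ne huu'.ne']
      exact (hcφ u' hu' huu').symm
    · rw [Function.update_of_ne h1]
      by_cases h2 : u' = v
      · subst h2
        rw [Function.update_self]
        exact hcφ u hu huu'.symm
      · rw [Function.update_of_ne h2]
        exact hφ u (Finset.mem_erase.2 ⟨h1, hu⟩) u' (Finset.mem_erase.2 ⟨h2, hu'⟩) huu'
  · by_cases hvw : G.Adj v w
    · have hmem : w ∈ G.neighborFinset v ∩ evenInside G B := by simp [hvw, hw]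
      refine ⟨d w, ?_⟩
      convert hd w hmem using 2
      ext u
      have hdc : c ≠ d w := fun he => hc.2 (Finset.mem_image.2 ⟨w, hmem, he.symm⟩)
      by_cases hu : u = v
      · subst hu
        simp [hdc]
      · simp [hu]
    · have hw' := mem_evenInside.1 hw
      have hnot : v ∉ G.neighborFinset w := by
        rw [mem_neighborFinset]
        exact fun h => hvw h.symm
      obtain ⟨c', hc'⟩ := hodd w
        (mem_evenInside.2 ⟨hw'.1, hw'.2.1, Finset.subset_erase.2 ⟨hw'.2.2, hnot⟩⟩)
      refine ⟨c', ?_⟩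
      convert hc' using 2
      refine Finset.filter_congr fun u hu => ?_
      rw [Function.update_of_ne]
      rintro rfl
      exact hnot hu

/-- In a graph of thickness at most `t`, girth at least six and with few vertices of small degree,
each set `B` has a vertex with few constraints. -/
lemma ThicknessLE.exists_card_add_card_lt {V : Type} [Fintype V] [DecidableEq V]
    {G : SimpleGraph V} [DecidableRel G.Adj] {t : ℕ} (ht : ThicknessLE G t) (ht2 : 2 ≤ t)
    (hg : (6 : ℕ∞) ≤ G.egirth)
    (hfew : (Finset.univ.filter fun v => G.degree v < 2 * t).card ≤ if t = 2 then 3 else 2)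
    {B : Finset V} (hB : B.Nonempty) :
    ∃ v ∈ B, (G.neighborFinset v ∩ B).card + (G.neighborFinset v ∩ evenInside G B).card <
      6 * t := by
  set A := evenInside G B with hA
  set W := B ∪ A \ B with hWdef
  by_cases hW : W.card < 4
  · obtain ⟨v, hv⟩ := hB
    refine ⟨v, hv, ?_⟩
    have hBW : B ⊆ W := Finset.subset_union_left
    have hAW : A ⊆ W := by
      rw [hWdef, Finset.union_sdiff_self_eq_union]
      exact Finset.subset_union_right
    have h1 := Finset.card_le_card (Finset.inter_subset_right.trans hBW : G.neighborFinset v ∩ B ⊆ W)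
    have h2 := Finset.card_le_card (Finset.inter_subset_right.trans hAW : G.neighborFinset v ∩ A ⊆ W)
    omega
  by_contra! hall
  have hsum := ht.sum_card_inter_le hg (not_lt.1 hW)
  have hcard : W.card = B.card + (A \ B).card := Finset.card_union_of_disjoint Finset.disjoint_sdiff
  have hmemA : ∀ w ∈ A \ B, Even (G.degree w) ∧ 0 < G.degree w ∧ G.neighborFinset w ⊆ B :=
    fun w hw => mem_evenInside.1 (Finset.mem_sdiff.1 hw).1
  have hA' : ∑ w ∈ A \ B, (G.neighborFinset w ∩ W).card = ∑ w ∈ A \ B, G.degree w :=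
    Finset.sum_congr rfl fun w hw => by
      rw [Finset.inter_eq_left.2 ((hmemA w hw).2.2.trans Finset.subset_union_left),
        card_neighborFinset_eq_degree]
  have hdouble : ∑ v ∈ B, (G.neighborFinset v ∩ (A \ B)).card = ∑ w ∈ A \ B, G.degree w := by
    have h1 : ∀ v, G.neighborFinset v ∩ (A \ B) = (A \ B).filter fun w => G.Adj v w := fun v => by
      ext w
      simp only [Finset.mem_inter, mem_neighborFinset, Finset.mem_filter]
      tauto
    have h2 : ∀ w ∈ A \ B, G.degree w = (B.filter fun v => G.Adj v w).card := fun w hw => by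
      rw [← card_neighborFinset_eq_degree]
      congr 1
      ext v
      have := @(hmemA w hw).2.2 v
      simp only [mem_neighborFinset, Finset.mem_filter, G.adj_comm v w] at this ⊢
      tauto
    rw [Finset.sum_congr rfl h2]
    simp only [h1, Finset.card_filter]
    exact Finset.sum_comm
  have hBsum : ∑ v ∈ B, (G.neighborFinset v ∩ W).card =
      ∑ v ∈ B, (G.neighborFinset v ∩ B).card + ∑ w ∈ A \ B, G.degree w := by
    rw [← hdouble, ← Finset.sum_add_distrib]
    refine Finset.sum_congr rfl fun v _ => ?_
    rw [hWdef, Finset.inter_union_distrib_left, Finset.card_union_of_disjoint]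
    exact Finset.disjoint_sdiff.mono Finset.inter_subset_right Finset.inter_subset_right
  rw [hWdef, Finset.sum_union Finset.disjoint_sdiff, ← hWdef, hA', hBsum, hcard] at hsum
  have hcost : 6 * t * B.card ≤
      2 * ∑ v ∈ B, (G.neighborFinset v ∩ B).card + ∑ w ∈ A \ B, G.degree w := by
    rw [← hdouble, Finset.mul_sum, ← Finset.sum_add_distrib, mul_comm, ← smul_eq_mul]
    refine Finset.card_nsmul_le_sum _ _ _ fun v hv => (hall v hv).trans ?_
    have h1 : G.neighborFinset v ∩ A ⊆ (G.neighborFinset v ∩ B) ∪ (G.neighborFinset v ∩ (A \ B)) := by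
      intro w
      simp only [Finset.mem_inter, Finset.mem_union, Finset.mem_sdiff]
      tauto
    have h2 := (Finset.card_le_card h1).trans (Finset.card_union_le _ _)
    omega
  have hdeg : (A \ B).card * (2 * t) ≤ ∑ w ∈ A \ B, G.degree w +
      (Finset.univ.filter fun v => G.degree v < 2 * t).card * (2 * t - 2) := by
    have h1 : (A \ B).card * (2 * t) ≤
        ∑ w ∈ A \ B, (G.degree w + if G.degree w < 2 * t then 2 * t - 2 else 0) := by
      rw [← smul_eq_mul]
      refine Finset.card_nsmul_le_sum _ _ _ fun w hw => ?_
      obtain ⟨⟨r, hr⟩, hpos, -⟩ := hmemA w hw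
      split_ifs <;> omega
    rw [Finset.sum_add_distrib, ← Finset.sum_filter, Finset.sum_const, smul_eq_mul] at h1
    refine h1.trans (Nat.add_le_add_left (Nat.mul_le_mul_right _ (Finset.card_le_card ?_)) _)
    exact Finset.filter_subset_filter _ (Finset.subset_univ _)
  obtain ⟨s, rfl⟩ : ∃ s, t = s + 1 := ⟨t - 1, by omega⟩
  have hs : 2 * (s + 1) - 2 = 2 * s := by omega
  rw [hs] at hdeg
  split_ifs at hfew with h2
  · have : s = 1 := by omega
    subst this
    nlinarith
  · nlinarith

/-- If `θ(G) = t ≥ 2`, `girth(G) ≥ 6`, and `G` has at most `n_t` vertices of degree `≤ 2t − 1`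
(where `n₂ = 3` and `n_t = 2` for `t ≥ 3`), then `χ_o(G) ≤ 6t`. -/
theorem oddChrom_le_of_few_small_degree_vertices {V : Type} [Fintype V] (G : SimpleGraph V)
    (t : ℕ) (ht : thickness G = t) (ht2 : 2 ≤ t)
    (hg : (6 : ℕ∞) ≤ G.egirth)
    (hfew : {v : V | deg G v ≤ 2 * t - 1}.ncard ≤ if t = 2 then 3 else 2) :
    oddChrom G ≤ 6 * t := by
  classical
  have hle : ThicknessLE G t := by
    have : 0 < thickness G := by omega
    exact ht ▸ Nat.sInf_mem (Nat.nonempty_of_pos_sInf this)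
  have hdeg : ∀ v, deg G v = G.degree v := fun v => by
    rw [deg, Set.ncard_eq_toFinset_card', ← card_neighborFinset_eq_degree, neighborFinset]
  have hsmall : {v : V | deg G v ≤ 2 * t - 1} =
      (Finset.univ.filter fun v => G.degree v < 2 * t : Finset V) := by
    ext v
    simp only [Set.mem_ofPred_eq, hdeg, Finset.coe_filter, Finset.mem_univ, true_and]
    omega
  rw [hsmall, Set.ncard_coe_finset] at hfew
  obtain ⟨φ, hφ, hodd⟩ := exists_coloring (G := G) (k := 6 * t) (by omega)
    (fun B hB => hle.exists_card_add_card_lt ht2 hg hfew hB) Finset.univ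
  refine Nat.sInf_le ⟨φ, fun u v huv => hφ u (Finset.mem_univ u) v (Finset.mem_univ v) huv,
    fun v hv => ?_⟩
  have hset : ∀ c, {u | u ∈ G.neighborSet v ∧ φ u = c} =
      ((G.neighborFinset v).filter fun u => φ u = c : Finset V) := fun c => by
    ext u
    simp
  simp only [hset, Set.ncard_coe_finset]
  rcases Nat.even_or_odd (G.degree v) with h | h
  · refine hodd v (mem_evenInside.2 ⟨h, ?_, Finset.subset_univ _⟩)
    obtain ⟨u, hu⟩ := hv
    exact (G.degree_pos_iff_exists_adj v).2 ⟨u, hu⟩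
  · exact exists_odd_card_filter (by rwa [card_neighborFinset_eq_degree]) φ
end

section
/- Let K_n* denote the graph obtained from the complete graph K_n by subdividing every edge exactly once. Then χ_o(K_n*) = n for all n ≥ 3. -/
open SimpleGraph

/-- `Knstar n` is the graph obtained from the complete graph `K_n` by subdividing each edge
exactly once: each edge `e` of `K_n` becomes a new vertex adjacent to both endpoints of `e`. -/
def Knstar (n : ℕ) : SimpleGraph (Fin n ⊕ {e : Sym2 (Fin n) // ¬ e.IsDiag}) :=
  SimpleGraph.fromRel (fun a b =>
    ∃ (u : Fin n) (e : {e : Sym2 (Fin n) // ¬ e.IsDiag}),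
      a = Sum.inl u ∧ b = Sum.inr e ∧ u ∈ e.val)

theorem Knstar_adj_inl_inr {n : ℕ} (u : Fin n) (e : {e : Sym2 (Fin n) // ¬ e.IsDiag}) :
    (Knstar n).Adj (Sum.inl u) (Sum.inr e) ↔ u ∈ e.val := by
  simp only [Knstar, SimpleGraph.fromRel_adj]
  grind

theorem Knstar_not_adj_inl_inl {n : ℕ} (u v : Fin n) :
    ¬ (Knstar n).Adj (Sum.inl u) (Sum.inl v) := by
  simp [Knstar, SimpleGraph.fromRel_adj]

theorem Knstar_not_adj_inr_inr {n : ℕ} (e f : {e : Sym2 (Fin n) // ¬ e.IsDiag}) :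
    ¬ (Knstar n).Adj (Sum.inr e) (Sum.inr f) := by
  simp [Knstar, SimpleGraph.fromRel_adj]

/-- A color that occurs exactly once among the neighbors of `v` occurs an odd number of times. -/
theorem odd_ncard_of_unique_neighbor {V : Type} {G : SimpleGraph V} {k : ℕ} {φ : V → Fin k}
    {v x : V} {c : Fin k} (hx : G.Adj v x) (hc : φ x = c)
    (huniq : ∀ y, G.Adj v y → φ y = c → y = x) :
    Odd ({u | u ∈ G.neighborSet v ∧ φ u = c}.ncard) := by
  have h : {u | u ∈ G.neighborSet v ∧ φ u = c} = {x} := by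
    ext y
    constructor
    · rintro ⟨h₁, h₂⟩
      exact huniq y h₁ h₂
    · rintro rfl
      exact ⟨hx, hc⟩
  rw [h, Set.ncard_singleton]
  exact odd_one

/-- The two neighbors of a subdivision vertex get distinct colors in an odd coloring. -/
theorem IsOddColoring.injective_inl {n k : ℕ}
    {φ : Fin n ⊕ {e : Sym2 (Fin n) // ¬ e.IsDiag} → Fin k} (h : IsOddColoring (Knstar n) φ) :
    Function.Injective fun u => φ (Sum.inl u) := by
  intro u v huv
  by_contra hne
  obtain ⟨c, hc⟩ := h.2 (Sum.inr ⟨s(u, v), by simpa using hne⟩)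
    ⟨Sum.inl u, ((Knstar_adj_inl_inr _ _).2 (by simp)).symm⟩
  have hmem : ∀ y, y ∈ (Knstar n).neighborSet (Sum.inr ⟨s(u, v), by simpa using hne⟩) ↔
      y = Sum.inl u ∨ y = Sum.inl v := by
    rintro (y | y)
    · rw [SimpleGraph.mem_neighborSet, SimpleGraph.adj_comm, Knstar_adj_inl_inr]
      simp
    · simp [Knstar_not_adj_inr_inr]
  simp only at huv
  by_cases hcu : φ (Sum.inl u) = c
  · have hset : {y | y ∈ (Knstar n).neighborSet (Sum.inr ⟨s(u, v), by simpa using hne⟩) ∧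
        φ y = c} = {Sum.inl u, Sum.inl v} := by
      ext y
      simp only [Set.mem_ofPred_eq, hmem, Set.mem_insert_iff, Set.mem_singleton_iff]
      grind
    rw [hset, Set.ncard_pair (by simpa using hne)] at hc
    exact absurd hc (by decide)
  · have hset : {y | y ∈ (Knstar n).neighborSet (Sum.inr ⟨s(u, v), by simpa using hne⟩) ∧
        φ y = c} = ∅ := by
      ext y
      simp only [Set.mem_ofPred_eq, hmem, Set.mem_empty_iff_false]
      grind
    rw [hset, Set.ncard_empty] at hc
    exact absurd hc (by decide)

/-- Given three distinct vertices `a`, `b`, `c` of `K_n`, color each original vertex by itself,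
and each subdivision vertex by the first of `a`, `b` that is not an endpoint of its edge, or by
`c` if the edge is `ab`. -/
def knstarColoring {n : ℕ} (a b c : Fin n) :
    Fin n ⊕ {e : Sym2 (Fin n) // ¬ e.IsDiag} → Fin n
  | Sum.inl u => u
  | Sum.inr e => if a ∉ e.val then a else if b ∉ e.val then b else c

theorem isOddColoring_knstarColoring {n : ℕ} {a b c : Fin n} (hab : a ≠ b) (hac : a ≠ c)
    (hbc : b ≠ c) : IsOddColoring (Knstar n) (knstarColoring a b c) := by
  have hproper : ∀ (u : Fin n) (e : {e : Sym2 (Fin n) // ¬ e.IsDiag}), u ∈ e.val →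
      knstarColoring a b c (Sum.inl u) ≠ knstarColoring a b c (Sum.inr e) := by
    rintro u ⟨e, he⟩ hu
    induction e with | _ x y =>
    simp only [knstarColoring, Sym2.mem_iff] at hu ⊢
    grind
  refine ⟨?_, ?_⟩
  · rintro (u | e) (v | f) h
    · exact absurd h (Knstar_not_adj_inl_inl u v)
    · exact hproper u f ((Knstar_adj_inl_inr _ _).1 h)
    · exact (hproper v e ((Knstar_adj_inl_inr _ _).1 h.symm)).symm
    · exact absurd h (Knstar_not_adj_inr_inr e f)
  · have key : ∀ (v w d : Fin n) (hvw : v ≠ w),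
        knstarColoring a b c (Sum.inr ⟨s(v, w), by simpa using hvw⟩) = d →
        (∀ (x : Fin n) (hvx : v ≠ x),
          knstarColoring a b c (Sum.inr ⟨s(v, x), by simpa using hvx⟩) = d → x = w) →
        Odd ({u | u ∈ (Knstar n).neighborSet (Sum.inl v) ∧
          knstarColoring a b c u = d}.ncard) := by
      intro v w d hvw hd huniq
      refine odd_ncard_of_unique_neighbor ((Knstar_adj_inl_inr _ _).2 (by simp)) hd ?_
      rintro (y | ⟨e, he⟩) hy hyd
      · exact absurd hy (Knstar_not_adj_inl_inl v y)
      · obtain ⟨x, rfl⟩ := (Knstar_adj_inl_inr _ _).1 hy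
        have hvx : v ≠ x := by simpa using he
        obtain rfl := huniq x hvx hyd
        rfl
    rintro (v | ⟨e, he⟩) -
    · by_cases hva : v = a
      · refine ⟨c, key v b c (hva ▸ hab) ?_ ?_⟩ <;>
          simp only [knstarColoring, Sym2.mem_iff] <;> grind
      by_cases hvb : v = b
      · refine ⟨c, key v a c hva ?_ ?_⟩ <;>
          simp only [knstarColoring, Sym2.mem_iff] <;> grind
      · refine ⟨b, key v a b hva ?_ ?_⟩ <;>
          simp only [knstarColoring, Sym2.mem_iff] <;> grind
    · induction e with | _ x y =>
      refine ⟨x, odd_ncard_of_unique_neighbor (x := Sum.inl x)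
        ((Knstar_adj_inl_inr _ _).2 (by simp)).symm rfl ?_⟩
      rintro (z | f) hz hzx
      · exact congrArg Sum.inl hzx
      · exact absurd hz (Knstar_not_adj_inr_inr _ _)

/-- The odd chromatic number of the 1-subdivision of `K_n` is `n`, for `n ≥ 3`. -/
theorem oddChrom_Knstar (n : ℕ) (hn : 3 ≤ n) : oddChrom (Knstar n) = n := by
  have hmem : n ∈ {k | ∃ φ : Fin n ⊕ {e : Sym2 (Fin n) // ¬ e.IsDiag} → Fin k,
      IsOddColoring (Knstar n) φ} :=
    ⟨_, isOddColoring_knstarColoring (a := ⟨0, by omega⟩) (b := ⟨1, by omega⟩)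
      (c := ⟨2, by omega⟩) (by simp) (by simp) (by simp)⟩
  refine le_antisymm (Nat.sInf_le hmem) (le_csInf ⟨n, hmem⟩ ?_)
  rintro k ⟨φ, hφ⟩
  simpa using Fintype.card_le_of_injective _ hφ.injective_inl
end
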